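/- For all integers n and m with n ≥ m + 1 ≥ 4, the Ramsey number of 4-uniform loose cycles satisfies R(C^4_n, C^4_m) = 3n + ⌊(m−1)/2⌋. -/

import Mathlib

/-- A copy of the `k`-uniform loose path with `n` edges, all of color `b`
(`true` = red, `false` = blue), in the coloring `col` of the `k`-subsets of `V`.
The path is given by an injective listing `f 0, f 1, …, f (n*(k-1))` of its
vertices, with `i`-th edge `{f (i*(k-1)), …, f (i*(k-1)+k-1)}`. -/
def HasLoosePath {V : Type*} [DecidableEq V] (k n : ℕ) (col : Finset V → Bool)
    (b : Bool) : Prop :=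
  ∃ f : ℕ → V, Set.InjOn f (Set.Iio (n * (k - 1) + 1)) ∧
    ∀ i < n, col ((Finset.range k).image fun j => f (i * (k - 1) + j)) = b

/-- A copy of the `k`-uniform loose cycle with `n` edges, all of color `b`
(`true` = red, `false` = blue), in the coloring `col` of the `k`-subsets of `V`.
The cycle is given by an injective listing `f 0, …, f (n*(k-1) - 1)` of its
vertices, with `i`-th edge `{f (i*(k-1) % (n*(k-1))), …, f ((i*(k-1)+k-1) % (n*(k-1)))}`. -/
def HasLooseCycle {V : Type*} [DecidableEq V] (k n : ℕ) (col : Finset V → Bool)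
    (b : Bool) : Prop :=
  ∃ f : ℕ → V, Set.InjOn f (Set.Iio (n * (k - 1))) ∧
    ∀ i < n, col ((Finset.range k).image fun j => f ((i * (k - 1) + j) % (n * (k - 1)))) = b

/-- `R(P^k_n, P^k_m)`: the least positive `N` such that every red-blue coloring of the
`k`-subsets of an `N`-set contains a red `P^k_n` or a blue `P^k_m`. -/
noncomputable def RamseyPP (k n m : ℕ) : ℕ :=
  sInf {N | 0 < N ∧ ∀ col : Finset (Fin N) → Bool,
    HasLoosePath k n col true ∨ HasLoosePath k m col false}

/-- `R(P^k_n, C^k_m)`. -/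
noncomputable def RamseyPC (k n m : ℕ) : ℕ :=
  sInf {N | 0 < N ∧ ∀ col : Finset (Fin N) → Bool,
    HasLoosePath k n col true ∨ HasLooseCycle k m col false}

/-- `R(C^k_n, P^k_m)`. -/
noncomputable def RamseyCP (k n m : ℕ) : ℕ :=
  sInf {N | 0 < N ∧ ∀ col : Finset (Fin N) → Bool,
    HasLooseCycle k n col true ∨ HasLoosePath k m col false}

/-- `R(C^k_n, C^k_m)`. -/
noncomputable def RamseyCC (k n m : ℕ) : ℕ :=
  sInf {N | 0 < N ∧ ∀ col : Finset (Fin N) → Bool,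
    HasLooseCycle k n col true ∨ HasLooseCycle k m col false}


set_option linter.all false

section Basics
variable {V : Type*} [DecidableEq V]

def Pth (col : Finset V → Bool) (b : Bool) : V → List (V × V × V) → V → Prop
  | u, [], v => u = v
  | u, (x, y, z) :: L, v => col {u, x, y, z} = b ∧ Pth col b z L v

def fl : List (V × V × V) → Multiset V
  | [] => 0
  | (x, y, z) :: L => {x} + {y} + {z} + fl L

def HC (col : Finset V → Bool) (b : Bool) (k : ℕ) : Prop :=
  ∃ u L, Pth col b u L u ∧ L.length = k ∧ (fl L).Nodup

lemma fl_append (L L' : List (V × V × V)) : fl (L ++ L') = fl L + fl L' := by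
  induction L with
  | nil => simp [fl]
  | cons t L ih => obtain ⟨x, y, z⟩ := t; simp only [List.cons_append, fl, ih]; abel

lemma Pth_append {col : Finset V → Bool} {b : Bool} (L L' : List (V × V × V)) (u w : V) :
    Pth col b u (L ++ L') w ↔ ∃ v, Pth col b u L v ∧ Pth col b v L' w := by
  induction L generalizing u with
  | nil => simp [Pth]
  | cons t L ih =>
    obtain ⟨x, y, z⟩ := t
    simp only [List.cons_append, Pth, ih]
    constructor
    · rintro ⟨h, v, h1, h2⟩; exact ⟨v, ⟨h, h1⟩, h2⟩
    · rintro ⟨v, ⟨h, h1⟩, h2⟩; exact ⟨h, v, h1, h2⟩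

lemma HC_of {col : Finset V → Bool} {b : Bool} {k : ℕ} {L L' : List (V × V × V)} {u v : V}
    (h1 : Pth col b u L v) (h2 : Pth col b v L' u) (hk : L.length + L'.length = k)
    (hn : (fl L + fl L').Nodup) : HC col b k :=
  ⟨u, L ++ L', (Pth_append _ _ _ _).2 ⟨v, h1, h2⟩, by simpa using hk, by rwa [fl_append]⟩

def stl : V → List (V × V × V) → List V
  | _, [] => []
  | u, (x, y, z) :: L => u :: x :: y :: stl z L

lemma stl_length (u : V) (L : List (V × V × V)) : (stl u L).length = 3 * L.length := by
  induction L generalizing u with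
  | nil => simp [stl]
  | cons t L ih => obtain ⟨x, y, z⟩ := t; simp [stl, ih]; omega

lemma stl_fl {col : Finset V → Bool} {b : Bool} (u v : V) (L : List (V × V × V))
    (h : Pth col b u L v) : (stl u L : Multiset V) + {v} = {u} + fl L := by
  induction L generalizing u with
  | nil => simp only [Pth] at h; simp [stl, fl, h]
  | cons t L ih =>
    obtain ⟨x, y, z⟩ := t
    have h3 := ih z h.2
    have : (↑(stl u ((x, y, z) :: L)) : Multiset V) = {u} + {x} + {y} + ↑(stl z L) := by
      simp only [stl, ← Multiset.cons_coe, ← Multiset.singleton_add]; abel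
    rw [this, add_assoc, h3]; simp only [fl]; abel

lemma stl_edge {col : Finset V → Bool} {b : Bool} (u v : V) (L : List (V × V × V))
    (h : Pth col b u L v) (i : ℕ) (hi : i < L.length) (d : V) :
    col ((Finset.range 4).image fun j => (stl u L ++ [v]).getD (3 * i + j) d) = b := by
  induction L generalizing u i with
  | nil => simp at hi
  | cons t L ih =>
    obtain ⟨x, y, z⟩ := t
    cases i with
    | zero =>
      rw [← h.1]; congr 1
      have hz : (stl z L ++ [v]).getD 0 d = z := by
        cases L with
        | nil => have := h.2; simp only [Pth] at this; simp [stl, this]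
        | cons t L => obtain ⟨x', y', z'⟩ := t; simp [stl]
      have : Finset.range 4 = {0, 1, 2, 3} := by decide
      rw [this]
      simp only [Finset.image_insert, Finset.image_singleton]
      simp only [stl, List.cons_append, List.getD_cons_zero, List.getD_cons_succ, Nat.mul_zero, Nat.zero_add, hz]
    | succ i =>
      have := ih z h.2 i (by simpa using hi)
      rw [← this]; congr 1

lemma HC_loose {col : Finset V → Bool} {b : Bool} {k : ℕ} (hk : 1 ≤ k) (h : HC col b k) :
    HasLooseCycle 4 k col b := by
  obtain ⟨u, L, hp, hl, hn⟩ := h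
  have hs := stl_fl u u L hp
  have hnd : (stl u L).Nodup := by
    rw [add_comm] at hs
    have := add_left_cancel hs
    rw [← Multiset.coe_nodup, this]; exact hn
  have hlen := stl_length u L
  refine ⟨fun n => (stl u L ++ [u]).getD n u, ?_, ?_⟩
  · intro x hx y hy hxy
    simp only [Set.mem_Iio] at hx hy
    have hx' : x < (stl u L).length := by rw [hlen, hl]; omega
    have hy' : y < (stl u L).length := by rw [hlen, hl]; omega
    simp only [List.getD_append _ _ _ _ hx', List.getD_append _ _ _ _ hy',
      List.getD_eq_getElem _ _ hx', List.getD_eq_getElem _ _ hy'] at hxy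
    exact (List.Nodup.getElem_inj_iff hnd).1 hxy
  · intro i hi
    rw [← stl_edge u u L hp i (by omega) u]
    congr 1
    apply Finset.image_congr
    intro j hj
    simp only [Finset.coe_range, Set.mem_Iio] at hj
    simp only [Nat.reduceSub]
    by_cases hc : 3 * i + j < k * 3
    · rw [Nat.mod_eq_of_lt (by omega), mul_comm i 3]
    · have h3 : 3 * i + j = k * 3 := by omega
      rw [mul_comm i 3, h3, Nat.mod_self]
      have e1 : (stl u L ++ [u]).getD (k * 3) u = u := by
        rw [List.getD_append_right _ _ _ _ (by rw [hlen, hl]; omega), hlen, hl, mul_comm k 3,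
          Nat.sub_self, List.getD_cons_zero]
      rw [e1]
      cases L with
      | nil => simp at hl; omega
      | cons t L => obtain ⟨x, y, z⟩ := t; simp [stl]

end Basics


lemma lower_red (n N q : ℕ) (hn : 1 ≤ n) (hN : N < 3 * n + q) :
    ¬ HasLooseCycle 4 n (fun e : Finset (Fin N) => decide (∀ v ∈ e, q ≤ v.1)) true := by
  rintro ⟨f, hf, hc⟩
  have h1 : ∀ t < n * 3, q ≤ (f t).1 := by
    intro t ht
    have := hc (t / 3) (by omega)
    simp only [decide_eq_true_eq] at this
    apply this
    rw [Finset.mem_image]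
    refine ⟨t % 3, by rw [Finset.mem_range]; omega, ?_⟩
    simp only [Nat.reduceSub]
    rw [Nat.mod_eq_of_lt (by omega)]; congr 1; omega
  have h2 : (Finset.range (n * 3)).card ≤ (Finset.Ico q N).card := by
    apply Finset.card_le_card_of_injOn (fun t => (f t).1)
    · intro t ht
      simp only [Finset.coe_range, Set.mem_Iio] at ht
      simp only [Finset.coe_Ico, Set.mem_Ico]
      exact ⟨h1 t ht, (f t).2⟩
    · intro x hx y hy hxy
      apply hf
      · simpa using hx
      · simpa using hy
      · exact Fin.ext hxy
  simp only [Finset.card_range, Nat.card_Ico] at h2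
  omega

lemma lower_blue (m N q : ℕ) (hq : 2 * q < m) :
    ¬ HasLooseCycle 4 m (fun e : Finset (Fin N) => decide (∀ v ∈ e, q ≤ v.1)) false := by
  rintro ⟨f, hf, hc⟩
  have h1 : ∀ i : ℕ, ∃ j, i < m → j < 4 ∧ (f ((i * 3 + j) % (m * 3))).1 < q := by
    intro i
    by_cases hi : i < m
    · have := hc i hi
      simp only [decide_eq_false_iff_not, not_forall, not_le] at this
      obtain ⟨v, hv, hvq⟩ := this
      rw [Finset.mem_image] at hv
      obtain ⟨j, hj, rfl⟩ := hv
      exact ⟨j, fun _ => ⟨Finset.mem_range.1 hj, hvq⟩⟩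
    · exact ⟨0, fun h => absurd h hi⟩
  choose j hj using h1
  have h2 := Finset.card_le_mul_card_image (f := fun i => (f ((i * 3 + j i) % (m * 3))).1) (Finset.range m) 2 ?_
  · have h3 : ((Finset.range m).image (fun i => (f ((i * 3 + j i) % (m * 3))).1)).card ≤ q := by
      rw [← Finset.card_range q]
      apply Finset.card_le_card
      intro v hv
      rw [Finset.mem_image] at hv
      obtain ⟨i, hi, rfl⟩ := hv
      rw [Finset.mem_range] at *
      exact (hj i hi).2
    rw [Finset.card_range] at h2
    omega
  · intro v hv
    rw [Finset.mem_image] at hv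
    obtain ⟨i0, hi0, rfl⟩ := hv
    set t := (i0 * 3 + j i0) % (m * 3) with ht
    have hm : 0 < m := by omega
    have htm : t < m * 3 := Nat.mod_lt _ (by omega)
    calc _ ≤ ({t / 3, (t / 3 + m - 1) % m} : Finset ℕ).card := by
          apply Finset.card_le_card
          intro i hi
          rw [Finset.mem_filter, Finset.mem_range] at hi
          obtain ⟨hi, hv⟩ := hi
          have hlt : (i * 3 + j i) % (m * 3) < m * 3 := Nat.mod_lt _ (by omega)
          have e := hf (by simpa using hlt) (by simpa using htm) (Fin.ext hv)
          have h4 := (hj i hi).1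
          rw [Finset.mem_insert, Finset.mem_singleton]
          by_cases hh : i * 3 + j i < m * 3
          · rw [Nat.mod_eq_of_lt hh] at e
            by_cases h3 : j i = 3
            · right
              have : t / 3 + m - 1 = i + m := by omega
              rw [this, Nat.add_mod_right, Nat.mod_eq_of_lt hi]
            · left; omega
          · have h5 : i * 3 + j i = m * 3 := by omega
            rw [h5, Nat.mod_self] at e
            right
            rw [← e, Nat.zero_div, Nat.zero_add, Nat.mod_eq_of_lt (by omega)]; omega
      _ ≤ 2 := Finset.card_le_two

lemma ramsey_main (n m : ℕ) (hm : 4 ≤ m + 1) (hnm : m + 1 ≤ n)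
    (up : ∀ col : Finset (Fin (3 * n + (m - 1) / 2)) → Bool, HC col true n ∨ HC col false m) :
    RamseyCC 4 n m = 3 * n + (m - 1) / 2 := by
  unfold RamseyCC
  apply le_antisymm
  · apply Nat.sInf_le
    refine ⟨by omega, fun col => ?_⟩
    rcases up col with h | h
    · exact Or.inl (HC_loose (by omega) h)
    · exact Or.inr (HC_loose (by omega) h)
  · apply le_csInf
    · refine ⟨3 * n + (m - 1) / 2, by omega, fun col => ?_⟩
      rcases up col with h | h
      · exact Or.inl (HC_loose (by omega) h)
      · exact Or.inr (HC_loose (by omega) h)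
    · rintro N ⟨hN, h⟩
      by_contra hlt
      rcases h (fun e => decide (∀ v ∈ e, (m - 1) / 2 ≤ v.1)) with h | h
      · exact lower_red n N _ (by omega) (by omega) h
      · exact lower_blue m N _ (by omega) h


section Cfgs
variable {V : Type*} [DecidableEq V]

def RR (col : Finset V → Bool) (W : Finset V) (x y z : V) : Finset V :=
  W.filter (fun w => col {x, y, z, w} = true)

lemma RR_swap (col : Finset V → Bool) (W : Finset V) (x y z : V) : RR col W x y z = RR col W y x z := by
  unfold RR
  have : ∀ w, ({x, y, z, w} : Finset V) = {y, x, z, w} := fun w => Finset.insert_comm _ _ _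
  simp only [this]

lemma RR_rot (col : Finset V → Bool) (W : Finset V) (x y z : V) : RR col W x y z = RR col W y z x := by
  unfold RR
  have : ∀ w, ({x, y, z, w} : Finset V) = {y, z, x, w} := by
    intro w; ext; simp only [Finset.mem_insert, Finset.mem_singleton]; tauto
  simp only [this]

lemma RR_mem {col : Finset V → Bool} {W : Finset V} {x y z w : V} :
    w ∈ RR col W x y z ↔ w ∈ W ∧ col {x, y, z, w} = true := by
  simp [RR]

lemma RR_not {col : Finset V → Bool} {W : Finset V} {x y z w : V} (hw : w ∈ W)
    (h : w ∉ RR col W x y z) : col {x, y, z, w} = false := by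
  rw [RR_mem] at h; simpa [hw] using h

structure Cfg (V : Type*) where
  c1 : V
  c2 : V
  s : V
  c3 : V
  c4 : V

def Cfg.vs (c : Cfg V) : Multiset V := {c.c1} + {c.c2} + {c.s} + {c.c3} + {c.c4}
def Cfg.X (col : Finset V → Bool) (W : Finset V) (c : Cfg V) : Finset V := RR col W c.c1 c.c2 c.s
def Cfg.Y (col : Finset V → Bool) (W : Finset V) (c : Cfg V) : Finset V := RR col W c.s c.c3 c.c4
def Cfg.flip (c : Cfg V) : Cfg V := ⟨c.c3, c.c4, c.s, c.c1, c.c2⟩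

lemma Cfg.flip_vs (c : Cfg V) : c.flip.vs = c.vs := by
  simp only [Cfg.flip, Cfg.vs]; abel
lemma Cfg.flip_X (col : Finset V → Bool) (W : Finset V) (c : Cfg V) : c.flip.X col W = c.Y col W := by
  simp only [Cfg.flip, Cfg.X, Cfg.Y]; rw [RR_rot, RR_rot]
lemma Cfg.flip_Y (col : Finset V → Bool) (W : Finset V) (c : Cfg V) : c.flip.Y col W = c.X col W := by
  simp only [Cfg.flip, Cfg.X, Cfg.Y]; rw [RR_rot]

def Mid (col : Finset V → Bool) (W : Finset V) : Cfg V → List (Cfg V) → List V → Prop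
  | _, [], [] => True
  | c, d :: cs, w :: l => w ∉ c.Y col W ∧ w ∉ d.X col W ∧ Mid col W d cs l
  | _, _, _ => False

def lastC : Cfg V → List (Cfg V) → Cfg V
  | c, [] => c
  | _, d :: cs => lastC d cs

def vss (cs : List (Cfg V)) : Multiset V := (cs.map Cfg.vs).sum

lemma vss_cons (c : Cfg V) (cs : List (Cfg V)) : vss (c :: cs) = c.vs + vss cs := by simp [vss]
lemma vss_perm {cs cs' : List (Cfg V)} (h : cs.Perm cs') : vss cs = vss cs' := by
  unfold vss; exact (h.map _).sum_eq

variable {col : Finset V → Bool} {W : Finset V}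

lemma blue_path (c : Cfg V) (cs : List (Cfg V)) (l : List V) (x y : V)
    (hm : Mid col W c cs l) (hx : x ∈ W) (hxc : x ∉ c.X col W) (hl : ∀ w ∈ l, w ∈ W)
    (hy : y ∈ W) (hyc : y ∉ (lastC c cs).Y col W) :
    ∃ B, Pth col false x B y ∧ B.length = 2 * (cs.length + 1) ∧
      fl B = vss (c :: cs) + (l : Multiset V) + {y} := by
  induction cs generalizing c l x with
  | nil =>
    cases l with
    | cons w l => simp [Mid] at hm
    | nil =>
      refine ⟨[(c.c1, c.c2, c.s), (c.c3, c.c4, y)], ⟨?_, ?_, rfl⟩, rfl, ?_⟩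
      · rw [← RR_not hx hxc]; congr 1; ext; simp only [Finset.mem_insert, Finset.mem_singleton]; tauto
      · exact RR_not hy hyc
      · simp only [fl, vss, List.map, List.sum_cons, List.sum_nil, Cfg.vs, Multiset.coe_nil]; abel
  | cons d cs ih =>
    cases l with
    | nil => simp [Mid] at hm
    | cons w l =>
      obtain ⟨h1, h2, h3⟩ := hm
      have hw : w ∈ W := hl w (by simp)
      obtain ⟨B, hB, hlen, hfl⟩ := ih d l w h3 hw h2 (fun v hv => hl v (by simp [hv])) hyc
      refine ⟨(c.c1, c.c2, c.s) :: (c.c3, c.c4, w) :: B, ⟨?_, ?_, hB⟩, by simp [hlen]; ring, ?_⟩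
      · rw [← RR_not hx hxc]; congr 1; ext; simp only [Finset.mem_insert, Finset.mem_singleton]; tauto
      · exact RR_not hw h1
      · rw [vss_cons, ← Multiset.cons_coe, ← Multiset.singleton_add]
        simp only [fl, hfl, Cfg.vs]; abel

def Le2 (col : Finset V → Bool) (W : Finset V) (c : Cfg V) : Prop :=
  (c.X col W).card ≤ 2 ∧ (c.Y col W).card ≤ 2

lemma pick {A B : Finset V} (h : B.card < A.card) : ∃ w ∈ A, w ∉ B := by
  by_contra hc; push Not at hc
  exact absurd (Finset.card_le_card hc) (by omega)

lemma fill (c : Cfg V) (cs : List (Cfg V)) (U : Finset V) (h2 : ∀ d ∈ c :: cs, Le2 col W d)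
    (hW : U.card + cs.length + 4 ≤ W.card) :
    ∃ l : List V, l.Nodup ∧ l.length = cs.length ∧ (∀ w ∈ l, w ∈ W) ∧ (∀ w ∈ l, w ∉ U) ∧ Mid col W c cs l := by
  induction cs generalizing c U with
  | nil => exact ⟨[], by simp, by simp, by simp, by simp, trivial⟩
  | cons d cs ih =>
    obtain ⟨w, hw, hn⟩ : ∃ w ∈ W, w ∉ U ∪ (c.Y col W ∪ d.X col W) := by
      apply pick
      have h3 := (h2 c (by simp)).2
      have h4 := (h2 d (by simp)).1
      have := Finset.card_union_le U (c.Y col W ∪ d.X col W)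
      have := Finset.card_union_le (c.Y col W) (d.X col W)
      simp at hW; omega
    simp only [Finset.mem_union, not_or] at hn
    obtain ⟨l, hl1, hl2, hl3, hl4, hl5⟩ := ih d (insert w U) (fun d hd => h2 d (by simp at hd ⊢; tauto))
      (by have := Finset.card_insert_le w U; simp at hW; omega)
    refine ⟨w :: l, ?_, by simp [hl2], ?_, ?_, hn.2.1, hn.2.2, hl5⟩
    · simp only [List.nodup_cons]; refine ⟨fun h => ?_, hl1⟩
      exact hl4 w h (by simp)
    · intro v hv; simp at hv; rcases hv with rfl | hv; exacts [hw, hl3 v hv]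
    · intro v hv; simp at hv; rcases hv with rfl | hv
      · exact hn.1
      · intro h; exact hl4 v hv (by simp [h])

/-- vertices of a list of configurations: no duplicates and outside W -/
def Ok (W : Finset V) (cs : List (Cfg V)) : Prop := (vss cs).Nodup ∧ ∀ v ∈ vss cs, v ∉ W

lemma Ok.perm {cs cs' : List (Cfg V)} (h : Ok W cs) (hp : cs.Perm cs') : Ok W cs' := by
  unfold Ok at *; rwa [← vss_perm hp]

lemma nodup_add3 {A : Multiset V} {l : List V} (hA : A.Nodup) (hAW : ∀ v ∈ A, v ∉ W)
    (hl : l.Nodup) (hlW : ∀ w ∈ l, w ∈ W) : (A + (l : Multiset V)).Nodup := by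
  rw [Multiset.nodup_add]
  refine ⟨hA, Multiset.coe_nodup.2 hl, ?_⟩
  rw [Multiset.disjoint_left]
  intro v hv hv'
  exact hAW v hv (hlW v (by simpa using hv'))

lemma close_even (c : Cfg V) (cs : List (Cfg V)) (l : List V) (z : V)
    (hok : Ok W (c :: cs)) (hm : Mid col W c cs l) (hl : ∀ w ∈ l, w ∈ W) (hln : l.Nodup)
    (hz : z ∈ W) (hzl : z ∉ l) (hzX : z ∉ c.X col W) (hzY : z ∉ (lastC c cs).Y col W) :
    HC col false (2 * (cs.length + 1)) := by
  obtain ⟨B, h1, h2, h3⟩ := blue_path c cs l z z hm hz hzX hl hz hzY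
  refine ⟨z, B, h1, h2, ?_⟩
  rw [h3]
  have := nodup_add3 (l := z :: l) hok.1 hok.2 (by simp [hzl, hln]) (by simp; exact ⟨hz, hl⟩)
  rw [← Multiset.cons_coe, ← Multiset.singleton_add] at this
  convert this using 1; abel

end Cfgs


section Even
variable {V : Type*} [DecidableEq V] {col : Finset V → Bool} {W : Finset V}

lemma lastC_mem (c : Cfg V) (cs : List (Cfg V)) : lastC c cs ∈ c :: cs := by
  induction cs generalizing c with
  | nil => simp [lastC]
  | cons d cs ih => have := ih d; simp only [lastC]; exact List.mem_cons_of_mem _ this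

lemma lastC_append (c a : Cfg V) (cs : List (Cfg V)) : lastC c (cs ++ [a]) = a := by
  induction cs generalizing c with
  | nil => simp [lastC]
  | cons d cs ih => exact ih d

def Sm (col : Finset V → Bool) (W : Finset V) (c : Cfg V) : Prop :=
  (c.X col W).card ≤ 1 ∧ (c.Y col W).card ≤ 1

def IsT (col : Finset V → Bool) (W : Finset V) (c : Cfg V) : Prop :=
  (c.X col W).card = 2 ∧ c.Y col W = c.X col W

def Ty (col : Finset V → Bool) (W : Finset V) (c : Cfg V) : Prop := Sm col W c ∨ IsT col W c

lemma Sm.le2 {c : Cfg V} (h : Sm col W c) : Le2 col W c := ⟨by have := h.1; omega, by have := h.2; omega⟩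
lemma IsT.le2 {c : Cfg V} (h : IsT col W c) : Le2 col W c := ⟨by rw [h.1], by rw [h.2, h.1]⟩
lemma Ty.le2 {c : Cfg V} (h : Ty col W c) : Le2 col W c := h.elim Sm.le2 IsT.le2

lemma pick2 {F G : Finset V} {l : List V} {k1 k2 : ℕ} (h1 : F.card ≤ k1) (h2 : G.card ≤ k2)
    (h : k1 + k2 + l.length < W.card) : ∃ w ∈ W, w ∉ F ∧ w ∉ G ∧ w ∉ l := by
  obtain ⟨w, hw, hn⟩ : ∃ w ∈ W, w ∉ F ∪ (G ∪ l.toFinset) := by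
    apply pick
    have := Finset.card_union_le F (G ∪ l.toFinset)
    have := Finset.card_union_le G l.toFinset
    have := List.toFinset_card_le l
    omega
  simp only [Finset.mem_union, List.mem_toFinset, not_or] at hn
  exact ⟨w, hw, hn⟩

lemma ev_void (c d : Cfg V) (ds : List (Cfg V)) (hok : Ok W (c :: d :: ds))
    (hX : c.X col W = ∅) (hY : c.Y col W = ∅) (h2 : ∀ e ∈ d :: ds, Le2 col W e)
    (hW : ds.length + 4 ≤ W.card) : HC col false (2 * (ds.length + 2)) := by
  obtain ⟨l, l1, l2, l3, l4, l5⟩ := fill d ds (∅ : Finset V) h2 (by simpa using hW)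
  obtain ⟨w, w1, w2, w3, w4⟩ := pick2 (W := W) (F := c.Y col W) (G := d.X col W) (l := l) (k1 := 0)
    (by simp [hY]) (h2 d (by simp)).1 (by omega)
  obtain ⟨z, z1, z2, z3, z4⟩ := pick2 (W := W) (F := c.X col W) (G := (lastC d ds).Y col W) (l := w :: l) (k1 := 0)
    (by simp [hX]) (h2 _ (lastC_mem d ds)).2 (by simp; omega)
  exact close_even c (d :: ds) (w :: l) z hok ⟨w2, w3, l5⟩ (by simp; exact ⟨w1, l3⟩)
    (by simp [w4, l1]) z1 z4 z2 z3

lemma ev_two (c c' : Cfg V) (cs : List (Cfg V)) (hok : Ok W (c :: c' :: cs))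
    (hc : Sm col W c) (hc' : Sm col W c') (h2 : ∀ e ∈ cs, Le2 col W e)
    (hW : cs.length + 4 ≤ W.card) : HC col false (2 * (cs.length + 2)) := by
  cases cs with
  | nil =>
    obtain ⟨w, w1, w2, w3, w4⟩ := pick2 (W := W) (F := c.Y col W) (G := c'.X col W) (l := [])
      hc.2 hc'.1 (by simp at *; omega)
    obtain ⟨z, z1, z2, z3, z4⟩ := pick2 (W := W) (F := c.X col W) (G := c'.Y col W) (l := [w])
      hc.1 hc'.2 (by simp at *; omega)
    exact close_even c [c'] [w] z hok ⟨w2, w3, trivial⟩ (by simpa using w1) (by simp) z1 z4 z2 z3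
  | cons d ds =>
    obtain ⟨l, l1, l2, l3, l4, l5⟩ := fill d ds (∅ : Finset V) h2 (by simp at *; omega)
    obtain ⟨w, w1, w2, w3, w4⟩ := pick2 (W := W) (F := c'.Y col W) (G := d.X col W) (l := l)
      hc'.2 (h2 d (by simp)).1 (by simp at *; omega)
    obtain ⟨z, z1, z2, z3, z4⟩ := pick2 (W := W) (F := c.X col W) (G := (lastC d ds).Y col W) (l := w :: l)
      hc.1 (h2 _ (lastC_mem d ds)).2 (by simp at *; omega)
    obtain ⟨v, v1, v2, v3, v4⟩ := pick2 (W := W) (F := c.Y col W) (G := c'.X col W) (l := z :: w :: l)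
      hc.2 hc'.1 (by simp at *; omega)
    simp only [List.mem_cons, not_or] at z4 v4
    exact close_even c (c' :: d :: ds) (v :: w :: l) z hok ⟨v2, v3, w2, w3, l5⟩ (by simp; exact ⟨v1, w1, l3⟩)
      (by simp [w4, l1, v4.2.1, v4.2.2]) z1 (by simp only [List.mem_cons, not_or]; exact ⟨Ne.symm v4.1, z4⟩) z2 z3

lemma card_union_bd {F G : Finset V} {k1 k2 : ℕ} (h1 : F.card ≤ k1) (h2 : G.card ≤ k2) :
    (F ∪ G).card ≤ k1 + k2 := by
  have := Finset.card_union_le F G; omega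

lemma ev_one_a (c b d : Cfg V) (ds : List (Cfg V)) (α : V) (hok : Ok W (c :: b :: d :: ds))
    (hc : Sm col W c) (hb : IsT col W b) (h2 : ∀ e ∈ d :: ds, Le2 col W e) (hα : α ∈ b.X col W)
    (hαc : α ∉ c.X col W) (hαl : α ∉ (lastC d ds).Y col W) (hαW : α ∈ W)
    (hW : ds.length + 5 ≤ W.card) : HC col false (2 * (ds.length + 3)) := by
  obtain ⟨l, l1, l2, l3, l4, l5⟩ := fill d ds {α} h2 (by simp at *; omega)
  obtain ⟨w, w1, w2, w3, w4⟩ := pick2 (W := W) (F := b.Y col W) (G := d.X col W) (l := l)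
      hb.le2.2 (h2 d (by simp)).1 (by simp at *; omega)
  obtain ⟨v, v1, v2, v3, v4⟩ := pick2 (W := W) (F := c.Y col W) (G := b.X col W) (l := w :: l)
      hc.2 hb.le2.1 (by simp at *; omega)
  simp only [List.mem_cons, not_or] at v4
  refine close_even c (b :: d :: ds) (v :: w :: l) α hok ⟨v2, v3, w2, w3, l5⟩ (by simp; exact ⟨v1, w1, l3⟩)
      (by simp [w4, l1, v4.1, v4.2]) hαW ?_ hαc hαl
  simp only [List.mem_cons, not_or]
  refine ⟨?_, ?_, ?_⟩
  · rintro rfl; exact v3 hα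
  · rintro rfl; rw [hb.2] at w2; exact w2 hα
  · intro h; exact l4 α h (by simp)

lemma X_sub (c : Cfg V) {w : V} (h : w ∈ c.X col W) : w ∈ W := (RR_mem.1 h).1

lemma ev_one_b (c a b : Cfg V) (cs : List (Cfg V)) (hok : Ok W (c :: a :: b :: cs))
    (hc : Sm col W c) (ha : IsT col W a) (hb : IsT col W b) (h2 : ∀ e ∈ cs, Le2 col W e)
    (hab : a.X col W = b.X col W)
    (hW : cs.length + 5 ≤ W.card) : HC col false (2 * (cs.length + 3)) := by
  cases cs with
  | nil =>
    obtain ⟨z, z1, z2, z3, z4⟩ := pick2 (W := W) (F := c.X col W) (G := b.Y col W) (l := [])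
      hc.1 hb.le2.2 (by simp at *; omega)
    obtain ⟨w, w1, w2, w3, w4⟩ := pick2 (W := W) (F := c.Y col W) (G := a.X col W) (l := [z])
      hc.2 ha.le2.1 (by simp at *; omega)
    obtain ⟨v, v1, v2, v3, v4⟩ := pick2 (W := W) (F := ∅) (G := a.X col W) (l := [z, w]) (k1 := 0)
      (by simp) ha.le2.1 (by simp at *; omega)
    simp only [List.mem_cons, not_or, List.not_mem_nil, not_false_eq_true, and_true] at w4 v4
    refine close_even c [a, b] [w, v] z hok ⟨w2, w3, by rw [ha.2]; exact v3, hab ▸ v3, trivial⟩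
      (by simp [w1, v1]) (by simp [Ne.symm v4.2]) z1 (by simp [Ne.symm v4.1, Ne.symm w4]) z2 z3
  | cons d ds =>
    obtain ⟨l, l1, l2, l3, l4, l5⟩ := fill d ds (∅ : Finset V) h2 (by simp at *; omega)
    obtain ⟨u, u1, u2, u3, u4⟩ := pick2 (W := W) (F := b.Y col W) (G := d.X col W) (l := l)
      hb.le2.2 (h2 d (by simp)).1 (by simp at *; omega)
    obtain ⟨z, z1, z2, z3, z4⟩ := pick2 (W := W) (F := c.X col W) (G := (lastC d ds).Y col W) (l := u :: l)
      hc.1 (h2 _ (lastC_mem d ds)).2 (by simp at *; omega)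
    obtain ⟨w, w1, w2, w3, w4⟩ := pick2 (W := W) (F := c.Y col W) (G := a.X col W) (l := z :: u :: l)
      hc.2 ha.le2.1 (by simp at *; omega)
    obtain ⟨v, v1, v2, v3, v4⟩ := pick2 (W := W) (F := ∅) (G := a.X col W) (l := w :: z :: u :: l) (k1 := 0)
      (by simp) ha.le2.1 (by simp at *; omega)
    simp only [List.mem_cons, not_or] at z4 w4 v4
    refine close_even c (a :: b :: d :: ds) (w :: v :: u :: l) z hok
      ⟨w2, w3, by rw [ha.2]; exact v3, hab ▸ v3, u2, u3, l5⟩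
      (by simp; exact ⟨w1, v1, u1, l3⟩) ?_ z1 ?_ z2 z3
    · simp only [List.nodup_cons, List.mem_cons, not_or]
      exact ⟨⟨Ne.symm v4.1, w4.2.1, w4.2.2⟩, ⟨v4.2.2.1, v4.2.2.2⟩, u4, l1⟩
    · simp only [List.mem_cons, not_or]
      exact ⟨Ne.symm w4.1, Ne.symm v4.2.1, z4⟩

lemma ev_one (c a b : Cfg V) (cs : List (Cfg V)) (hok : Ok W (c :: a :: b :: cs))
    (hc : Sm col W c) (ha : IsT col W a) (hb : IsT col W b) (h2 : ∀ e ∈ cs, Le2 col W e)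
    (hW : cs.length + 5 ≤ W.card) : HC col false (2 * (cs.length + 3)) := by
  by_cases hab : a.X col W = b.X col W
  · exact ev_one_b c a b cs hok hc ha hb h2 hab hW
  have key : ∀ a b : Cfg V, Ok W (c :: a :: b :: cs) → IsT col W a → IsT col W b →
      (∃ α ∈ b.X col W, α ∉ a.X col W ∧ α ∉ c.X col W) → HC col false (2 * (cs.length + 3)) := by
    rintro a b hok ha hb ⟨α, h1, h3, h4⟩
    have hp : (c :: a :: b :: cs).Perm (c :: b :: (cs ++ [a])) := by
      refine List.Perm.cons _ ?_
      refine (List.Perm.swap _ _ _).trans (List.Perm.cons _ ?_)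
      exact (List.perm_append_singleton a cs).symm
    have hok' := hok.perm hp
    rcases hcs : cs ++ [a] with _ | ⟨d, ds⟩
    · simp at hcs
    · rw [hcs] at hok'
      have hl : ds.length = cs.length := by
        have := congrArg List.length hcs; simp at this; omega
      have hla : lastC d ds = a := by
        have := lastC_append c a cs; rw [hcs] at this; exact this
      rw [← hl]
      refine ev_one_a c b d ds α hok' hc hb ?_ h1 h4 (by rw [hla, ha.2]; exact h3) (X_sub b h1) (by omega)
      rw [← hcs]; intro e he; simp only [List.mem_append, List.mem_singleton] at he
      rcases he with he | rfl; exacts [h2 e he, ha.le2]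
  by_cases h3 : ∃ α ∈ b.X col W, α ∉ a.X col W ∧ α ∉ c.X col W
  · exact key a b hok ha hb h3
  by_cases h4 : ∃ α ∈ a.X col W, α ∉ b.X col W ∧ α ∉ c.X col W
  · exact key b a (hok.perm ((List.Perm.swap _ _ _).cons _)) hb ha h4
  exfalso
  push Not at h3 h4
  have e1 : ¬ b.X col W ⊆ a.X col W := fun h => hab (Finset.eq_of_subset_of_card_le h (by rw [ha.1, hb.1])).symm
  have e2 : ¬ a.X col W ⊆ b.X col W := fun h => hab (Finset.eq_of_subset_of_card_le h (by rw [ha.1, hb.1]))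
  rw [Finset.not_subset] at e1 e2
  obtain ⟨x, x1, x2⟩ := e1
  obtain ⟨y, y1, y2⟩ := e2
  have := Finset.card_le_one.1 hc.1 x (h3 x x1 x2) y (h4 y y1 y2)
  subst this; exact x2 y1

lemma mid_same (D : Finset V) (c : Cfg V) (cs : List (Cfg V)) (l : List V)
    (h : ∀ e ∈ c :: cs, e.X col W ⊆ D ∧ e.Y col W ⊆ D) (hl : ∀ w ∈ l, w ∉ D) (hlen : l.length = cs.length) :
    Mid col W c cs l := by
  induction cs generalizing c l with
  | nil => have := List.length_eq_zero_iff.1 hlen; subst this; trivial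
  | cons d cs ih =>
    cases l with
    | nil => simp at hlen
    | cons w l =>
      exact ⟨fun hh => hl w (by simp) ((h c (by simp)).2 hh), fun hh => hl w (by simp) ((h d (by simp)).1 hh),
        ih d l (fun e he => h e (List.mem_cons_of_mem _ he)) (fun v hv => hl v (by simp [hv])) (by simpa using hlen)⟩

lemma get_list (D : Finset V) (k : ℕ) (h : D.card + k ≤ W.card) :
    ∃ l : List V, l.Nodup ∧ l.length = k ∧ (∀ w ∈ l, w ∈ W) ∧ ∀ w ∈ l, w ∉ D := by
  have : k ≤ (W \ D).card := by have := Finset.le_card_sdiff D W; omega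
  obtain ⟨t, ht, hk⟩ := Finset.exists_subset_card_eq this
  refine ⟨t.toList, t.nodup_toList, by simp [hk], ?_, ?_⟩ <;>
  · intro w hw; have := ht (by simpa using hw); simp at this; tauto

lemma ev_same (D : Finset V) (c : Cfg V) (cs : List (Cfg V)) (hok : Ok W (c :: cs))
    (h : ∀ e ∈ c :: cs, e.X col W ⊆ D ∧ e.Y col W ⊆ D) (hD : D.card ≤ 2)
    (hW : cs.length + 3 ≤ W.card) : HC col false (2 * (cs.length + 1)) := by
  obtain ⟨l, l1, l2, l3, l4⟩ := get_list (W := W) D (cs.length + 1) (by omega)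
  cases l with
  | nil => simp at l2
  | cons z l =>
    simp only [List.mem_cons, forall_eq_or_imp, List.nodup_cons] at *
    have hl := lastC_mem c cs
    refine close_even c cs l z hok (mid_same D c cs l ?_ l4.2 (by simpa using l2)) l3.2 l1.2 l3.1 l1.1 ?_ ?_
    · simpa using h
    · exact fun hh => l4.1 (h.1.1 hh)
    · intro hh
      apply l4.1
      rcases List.mem_cons.1 hl with e | e
      · rw [e] at hh; exact h.1.2 hh
      · exact (h.2 _ e).2 hh
end Even


section Window
variable {V : Type*} [DecidableEq V] {col : Finset V → Bool} {W : Finset V}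

lemma hall2 {S1 S2 S3 : Finset V} (h1 : 2 ≤ S1.card) (h2 : 2 ≤ S2.card) (h3 : S3.Nonempty)
    (h : ∀ w1 ∈ S1, ∀ w2 ∈ S2, ∀ w3 ∈ S3, w1 ≠ w2 → w1 ≠ w3 → w2 ≠ w3 → False) :
    S1.card = 2 ∧ S2 = S1 ∧ S3 ⊆ S1 := by
  have key : ∀ w3 ∈ S3, (S1.erase w3).card = 1 ∧ S2.erase w3 = S1.erase w3 := by
    intro w3 hw3
    have c1 : 1 ≤ (S1.erase w3).card := by have := Finset.pred_card_le_card_erase (s := S1) (a := w3); omega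
    have c2 : 1 ≤ (S2.erase w3).card := by have := Finset.pred_card_le_card_erase (s := S2) (a := w3); omega
    have e : ∀ x ∈ S1.erase w3, ∀ y ∈ S2.erase w3, x = y := by
      intro x hx y hy
      simp only [Finset.mem_erase] at hx hy
      by_contra hne
      exact h x hx.2 y hy.2 w3 hw3 hne hx.1 hy.1
    obtain ⟨x, hx⟩ := Finset.card_pos.1 (by omega : 0 < (S1.erase w3).card)
    obtain ⟨y, hy⟩ := Finset.card_pos.1 (by omega : 0 < (S2.erase w3).card)
    have e1 : S1.erase w3 = {y} := Finset.eq_singleton_iff_unique_mem.2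
      ⟨by rw [← e x hx y hy]; exact hx, fun z hz => e z hz y hy⟩
    have e2 : S2.erase w3 = {x} := Finset.eq_singleton_iff_unique_mem.2
      ⟨by rw [e x hx y hy]; exact hy, fun z hz => (e x hx z hz).symm⟩
    exact ⟨by rw [e1]; simp, by rw [e1, e2, e x hx y hy]⟩
  have mem : ∀ w3 ∈ S3, w3 ∈ S1 ∧ w3 ∈ S2 := by
    intro w3 hw3
    obtain ⟨k1, k2⟩ := key w3 hw3
    constructor
    · by_contra hn
      rw [Finset.erase_eq_of_notMem hn] at k1; omega
    · by_contra hn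
      rw [Finset.erase_eq_of_notMem hn] at k2; rw [← k2] at k1; omega
  obtain ⟨w, hw⟩ := h3
  obtain ⟨k1, k2⟩ := key w hw
  obtain ⟨m1, m2⟩ := mem w hw
  refine ⟨?_, ?_, fun x hx => (mem x hx).1⟩
  · have := Finset.card_erase_add_one m1; omega
  · rw [← Finset.insert_erase m1, ← Finset.insert_erase m2, k2]

def NoSDR (col : Finset V → Bool) (W : Finset V) (a : V) (M : Multiset V) (g : V) : Prop :=
  ∀ i p j q k, {i} + {p} + {j} + {q} + {k} = M → ∀ w1 ∈ RR col W a i p, ∀ w2 ∈ RR col W p j q,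
    ∀ w3 ∈ RR col W q k g, w1 ≠ w2 → w1 ≠ w3 → w2 ≠ w3 → False

def NS (col : Finset V → Bool) (W : Finset V) (a : V) (M : Multiset V) : Prop :=
  ∀ (c : Cfg V) (o : V), c.vs + {o} = {a} + M → ¬ Sm col W c

lemma noSDR_of {a g : V} {M : Multiset V} {Q : List (V × V × V)} {k : ℕ}
    (hQ : Pth col true g Q a) (hk : 3 + Q.length = k) (hno : ¬ HC col true k)
    (hn : (M + {g} + fl Q).Nodup) (hW : ∀ v ∈ M + {g} + fl Q, v ∉ W) : NoSDR col W a M g := by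
  intro i p j q k' hp w1 h1 w2 h2 w3 h3 n1 n2 n3
  apply hno
  rw [RR_mem] at h1 h2 h3
  refine HC_of (L := [(i, w1, p), (j, w2, q), (k', w3, g)]) (u := a) (v := g) ⟨?_, ?_, ?_, rfl⟩ hQ hk ?_
  · rw [← h1.2]; congr 1; ext; simp only [Finset.mem_insert, Finset.mem_singleton]; tauto
  · rw [← h2.2]; congr 1; ext; simp only [Finset.mem_insert, Finset.mem_singleton]; tauto
  · rw [← h3.2]; congr 1; ext; simp only [Finset.mem_insert, Finset.mem_singleton]; tauto
  · have := nodup_add3 (l := [w1, w2, w3]) hn hW (by simp [n1, n2, n3]) (by simp [h1.1, h2.1, h3.1])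
    convert this using 1
    rw [← hp]
    simp only [fl, ← Multiset.cons_coe, ← Multiset.singleton_add, Multiset.coe_nil]
    abel

variable {a g : V} {M : Multiset V}

lemma path_eq (hN : NoSDR col W a M g) {i p j q k : V} (hp : {i} + {p} + {j} + {q} + {k} = M)
    (h1 : 2 ≤ (RR col W a i p).card) (h2 : 2 ≤ (RR col W p j q).card) (h3 : (RR col W q k g).Nonempty) :
    (RR col W a i p).card = 2 ∧ RR col W p j q = RR col W a i p ∧ RR col W q k g ⊆ RR col W a i p :=
  hall2 h1 h2 h3 (hN i p j q k hp)

/-- configuration inside M -/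
lemma ns_in (hS : NS col W a M) {x y z q k : V} (hp : {x} + {y} + {z} + {q} + {k} = M) :
    2 ≤ (RR col W x z q).card ∨ 2 ≤ (RR col W y z k).card := by
  by_contra hc; push Not at hc
  refine hS ⟨x, q, z, y, k⟩ a ?_ ⟨?_, ?_⟩
  · rw [← hp]; simp only [Cfg.vs]; abel
  · show (RR col W x q z).card ≤ 1
    rw [RR_swap, RR_rot, RR_swap]
    rw [RR_rot] at hc; rw [RR_swap, RR_rot]; omega
  · show (RR col W z y k).card ≤ 1
    rw [RR_swap]; omega

/-- configuration centred at a -/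
lemma ns_a (hS : NS col W a M) {w x y z o : V} (hp : {w} + {x} + {y} + {z} + {o} = M) :
    2 ≤ (RR col W a w x).card ∨ 2 ≤ (RR col W a y z).card := by
  by_contra hc; push Not at hc
  refine hS ⟨w, x, a, y, z⟩ o ?_ ⟨?_, ?_⟩
  · rw [← hp]; simp only [Cfg.vs]; abel
  · show (RR col W w x a).card ≤ 1
    rw [RR_rot] at hc; omega
  · show (RR col W a y z).card ≤ 1
    omega

/-- configuration using a non-centrally -/
lemma ns_p (hS : NS col W a M) {i p j q k : V} (hp : {i} + {p} + {j} + {q} + {k} = M) :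
    2 ≤ (RR col W a i p).card ∨ 2 ≤ (RR col W p j q).card := by
  by_contra hc; push Not at hc
  refine hS ⟨a, i, p, j, q⟩ k ?_ ⟨?_, ?_⟩
  · rw [← hp]; simp only [Cfg.vs]; abel
  · show (RR col W a i p).card ≤ 1
    omega
  · show (RR col W p j q).card ≤ 1
    omega

lemma RR_sw2 (x y z : V) : RR col W x y z = RR col W x z y := by
  rw [RR_rot, RR_swap, RR_rot, RR_rot]

lemma reach (hN : NoSDR col W a M g) (hS : NS col W a M) {x y z q k : V}
    (hp : {x} + {y} + {z} + {q} + {k} = M)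
    (h1 : 2 ≤ (RR col W a x y).card) (h3 : (RR col W q k g).Nonempty) :
    ∃ i p j q k, {i} + {p} + {j} + {q} + {k} = M ∧ (RR col W a i p).card = 2 ∧
      RR col W p j q = RR col W a i p ∧ RR col W q k g ⊆ RR col W a i p := by
  rcases ns_in hS hp with h | h
  · refine ⟨y, x, z, q, k, by rw [← hp]; abel, path_eq hN (by rw [← hp]; abel) (by rwa [RR_sw2]) h h3⟩
  · refine ⟨x, y, z, k, q, by rw [← hp]; abel, path_eq hN (by rw [← hp]; abel) h1 h (by rwa [RR_swap])⟩

def Vd (col : Finset V → Bool) (W : Finset V) (M : Multiset V) (g : V) : Prop :=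
  ∀ o w x y z, {o} + {w} + {x} + {y} + {z} = M →
    ∃ c : Cfg V, c.vs + {o} = M + {g} ∧ c.X col W = ∅ ∧ c.Y col W = ∅

/-- `Rch a q k x y z`: some pair of the triple x,y,z is big with a -/
lemma reach2 (hS : NS col W a M) {o w x y z : V} (hp : {o} + {w} + {x} + {y} + {z} = M)
    (P : V → V → Prop) (hP : ∀ x y, P x y → P y x)
    (hr : ∀ x y z q k, {x} + {y} + {z} + {q} + {k} = M → 2 ≤ (RR col W a x y).card → P q k) :
    (P w x ∧ P y z) ∨ (P w y ∧ P x z) := by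
  have key : ∀ q k x y z, {x} + {y} + {z} + {q} + {k} = M → ¬ P q k →
      (RR col W a x y).card < 2 ∧ (RR col W a x z).card < 2 ∧ (RR col W a y z).card < 2 := by
    intro q k x y z hp hn
    refine ⟨?_, ?_, ?_⟩ <;> by_contra hc <;> push Not at hc
    · exact hn (hr x y z q k hp hc)
    · exact hn (hr x z y q k (by rw [← hp]; abel) hc)
    · exact hn (hr y z x q k (by rw [← hp]; abel) hc)
  have sep : ∀ q k x y z q' k' x' y' z' r, {x} + {y} + {z} + {q} + {k} = M → 
      {x'} + {y'} + {z'} + {q'} + {k'} = M → ({x} + {y} + {x'} + {y'} + {r} : Multiset V) = M →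
      P q k ∨ P q' k' := by
    intro q k x y z q' k' x' y' z' r h1 h2 h3
    by_contra hc; push Not at hc
    have := key _ _ _ _ _ h1 hc.1
    have h4 := key _ _ _ _ _ h2 hc.2
    have := ns_a hS h3
    omega
  by_contra hc
  rw [not_or, not_and_or, not_and_or] at hc
  -- unreachable pairs κ1 ∈ {wx, yz}, κ2 ∈ {wy, xz}
  have s1 := sep w x y o z w y x z o w (by rw [← hp]; abel) (by rw [← hp]; abel) (by rw [← hp]; abel)
  have s2 := sep w x z o y x z w y o x (by rw [← hp]; abel) (by rw [← hp]; abel) (by rw [← hp]; abel)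
  have s3 := sep y z w o x w y x z o y (by rw [← hp]; abel) (by rw [← hp]; abel) (by rw [← hp]; abel)
  have s4 := sep y z x o w x z w y o z (by rw [← hp]; abel) (by rw [← hp]; abel) (by rw [← hp]; abel)
  tauto

lemma tri (hN : NoSDR col W a M g) :
    (∃ (c : Cfg V) (o : V), c.vs + {o} = {a} + M ∧ Sm col W c) ∨
    (∃ i p j q k, {i} + {p} + {j} + {q} + {k} = M ∧ (RR col W a i p).card = 2 ∧
      RR col W p j q = RR col W a i p ∧ RR col W q k g ⊆ RR col W a i p) ∨ Vd col W M g := by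
  by_cases hS : NS col W a M
  swap
  · left
    unfold NS at hS; push Not at hS; exact hS
  right
  by_contra hc
  rw [not_or] at hc
  apply hc.2
  intro o w x y z hp
  have hr : ∀ x y z q k, {x} + {y} + {z} + {q} + {k} = M → 2 ≤ (RR col W a x y).card → RR col W q k g = ∅ := by
    intro x y z q k hp h
    by_contra hne
    exact hc.1 (reach hN hS hp h (Finset.nonempty_iff_ne_empty.2 hne))
  rcases reach2 hS hp (fun q k => RR col W q k g = ∅) (fun x y h => by rwa [RR_swap]) hr with ⟨h1, h2⟩ | ⟨h1, h2⟩
  · exact ⟨⟨w, x, g, y, z⟩, by rw [← hp]; simp only [Cfg.vs]; abel, h1, by show RR col W g y z = ∅; rwa [RR_rot]⟩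
  · exact ⟨⟨w, y, g, x, z⟩, by rw [← hp]; simp only [Cfg.vs]; abel, h1, by show RR col W g x z = ∅; rwa [RR_rot]⟩

end Window


section Chain
variable {V : Type*} [DecidableEq V] {col : Finset V → Bool} {W : Finset V}

/-- disjoint from W and without duplicates -/
def Fr (W : Finset V) (A : Multiset V) : Prop := A.Nodup ∧ ∀ v ∈ A, v ∉ W

lemma Fr.le {A B : Multiset V} (h : Fr W B) (hle : A ≤ B) : Fr W A :=
  ⟨Multiset.nodup_of_le hle h.1, fun v hv => h.2 v (Multiset.mem_of_le hle hv)⟩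

lemma Fr.of_add {A B C : Multiset V} (h : Fr W B) (he : A + C = B) : Fr W A :=
  h.le (he ▸ Multiset.le_add_right A C)

lemma Fr.add_list {A : Multiset V} {l : List V} (h : Fr W A) (hl : l.Nodup) (hw : ∀ w ∈ l, w ∈ W) :
    (A + (l : Multiset V)).Nodup := nodup_add3 h.1 h.2 hl hw

lemma blue3 {i p j q k a g : V} (hf : Fr W ({i} + {p} + {j} + {q} + {k} + {a} + {g}))
    (hc : (RR col W a i p).card = 2) (h2 : RR col W p j q = RR col W a i p)
    (h3 : RR col W q k g ⊆ RR col W a i p) (hW : 4 ≤ W.card) : HC col false 3 := by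
  obtain ⟨l, l1, l2, l3, l4⟩ := get_list (W := W) (RR col W a i p) 2 (by omega)
  obtain ⟨x, y, rfl⟩ := List.length_eq_two.1 l2
  simp only [List.mem_cons, List.not_mem_nil, or_false, forall_eq_or_imp, forall_eq] at l3 l4
  refine ⟨x, [(a, i, p), (j, y, q), (k, g, x)], ⟨?_, ?_, ?_, rfl⟩, rfl, ?_⟩
  · rw [← RR_not l3.1 l4.1]; congr 1; ext; simp only [Finset.mem_insert, Finset.mem_singleton]; tauto
  · rw [← h2] at l4; rw [← RR_not l3.2 l4.2]; congr 1; ext; simp only [Finset.mem_insert, Finset.mem_singleton]; tauto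
  · rw [← RR_not l3.1 (fun h => l4.1 (h3 h))]
  · have := hf.add_list l1 (by simp [l3])
    convert this using 1
    simp only [fl, ← Multiset.cons_coe, ← Multiset.singleton_add, Multiset.coe_nil]
    abel

def TyH (col : Finset V → Bool) (W : Finset V) (c : Cfg V) : Prop :=
  Sm col W c ∨ (IsT col W c ∧ HC col false 3)

lemma TyH.ty {c : Cfg V} (h : TyH col W c) : Ty col W c := h.imp id And.left

lemma tri2 {a g : V} {M : Multiset V} (hN : NoSDR col W a M g) (hf : Fr W (M + {a} + {g})) (hW : 4 ≤ W.card) :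
    (∃ (c : Cfg V) (o : V), c.vs + {o} = {a} + M ∧ TyH col W c) ∨ Vd col W M g := by
  rcases tri hN with ⟨c, o, h1, h2⟩ | ⟨i, p, j, q, k, hp, h1, h2, h3⟩ | h
  · exact Or.inl ⟨c, o, h1, Or.inl h2⟩
  · refine Or.inl ⟨⟨a, i, p, j, q⟩, k, ?_, Or.inr ⟨⟨h1, h2⟩, ?_⟩⟩
    · rw [← hp]; simp only [Cfg.vs]; abel
    · rw [← hp] at hf
      exact blue3 hf h1 h2 h3 hW
  · exact Or.inr h

lemma chain (p : ℕ) : ∀ (J e a : V) (L Q0 Q0' : List (V × V × V)), L.length = 2 * (p + 1) →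
    Pth col true J L e → Pth col true e Q0 J → Pth col true e Q0' a → fl Q0' = fl Q0 → Q0'.length = Q0.length →
    Fr W (fl L + fl Q0) → a ∈ fl Q0 → 4 ≤ W.card → ¬ HC col true (L.length + Q0.length + 1) →
    ∃ (cs : List (Cfg V)) (a' : V) (F : Multiset V) (L' : List (V × V × V)), cs.length = p + 1 ∧
      (∀ c ∈ cs, TyH col W c) ∧ Pth col true J L' a' ∧ L'.length = L.length ∧ fl L' = fl L ∧
      vss cs + {a'} + F = {a} + fl L := by
  induction p with
  | zero =>
    intro J e a L Q0 Q0' hL hp hQ hQ' hfl hlen hf ha hW hno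
    obtain ⟨⟨x2, x3, x4⟩, ⟨x5, x6, x7⟩, rfl⟩ := List.length_eq_two.1 hL
    simp only [Pth] at hp
    obtain ⟨h1, h2, rfl⟩ := hp
    simp only [fl] at hf
    have hN : NoSDR col W a ({x2} + {x3} + {x4} + {x5} + {x6}) x7 := by
      have e : {x2} + {x3} + {x4} + {x5} + {x6} + {x7} + fl Q0' =
        ({x2} + {x3} + {x4} + ({x5} + {x6} + {x7} + 0) + fl Q0) := by rw [hfl]; abel
      refine noSDR_of hQ' rfl (fun h => hno ?_) (by rw [e]; exact hf.1) (by rw [e]; exact hf.2)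
      rw [hlen] at h; convert h using 1; simp; ring
    obtain ⟨Q1, hQ1⟩ := Multiset.exists_cons_of_mem ha
    rw [← Multiset.singleton_add] at hQ1
    rcases tri2 hN (hf.of_add (C := Q1) (by rw [hQ1]; abel)) hW with ⟨c, o, hc, ht⟩ | hV
    · refine ⟨[c], x7, {o}, [(x2, x3, x4), (x5, x6, x7)], rfl, by simpa using ht, ⟨h1, h2, rfl⟩, rfl, rfl, ?_⟩
      rw [vss_cons]; simp only [fl, vss, List.map_nil, List.sum_nil]
      calc _ = (c.vs + {o}) + {x7} := by abel
        _ = _ := by rw [hc]; abel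
    · obtain ⟨c, hc, hX, hY⟩ := hV x6 x2 x3 x4 x5 (by abel)
      refine ⟨[c], x6, {a}, [(x2, x3, x4), (x5, x7, x6)], rfl,
        by simp only [List.mem_singleton, forall_eq]; exact Or.inl ⟨by rw [hX]; simp, by rw [hY]; simp⟩, ⟨h1, ?_, rfl⟩, rfl, by simp only [fl]; abel, ?_⟩
      · rw [← h2]; congr 1; ext; simp only [Finset.mem_insert, Finset.mem_singleton]; tauto
      · rw [vss_cons]; simp only [fl, vss, List.map_nil, List.sum_nil]
        calc _ = (c.vs + {x6}) + {a} := by abel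
          _ = _ := by rw [hc]; abel
  | succ p ih =>
    intro J e a L Q0 Q0' hL hp hQ hQ' hfl hlen hf ha hW hno
    obtain ⟨⟨x2, x3, x4⟩, L1, rfl⟩ := List.exists_cons_of_length_eq_add_one (n := 2 * (p+1) + 1) (by rw [hL]; ring)
    obtain ⟨⟨x5, x6, x7⟩, L, rfl⟩ := List.exists_cons_of_length_eq_add_one (l := L1) (n := 2 * (p+1)) (by simp at hL; omega)
    simp only [Pth] at hp
    obtain ⟨h1, h2, h3⟩ := hp
    simp only [fl] at hf
    have hN : NoSDR col W a ({x2} + {x3} + {x4} + {x5} + {x6}) x7 := by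
      have e : {x2} + {x3} + {x4} + {x5} + {x6} + {x7} + fl (L ++ Q0') =
        ({x2} + {x3} + {x4} + ({x5} + {x6} + {x7} + fl L) + fl Q0) := by rw [fl_append, hfl]; abel
      refine noSDR_of ((Pth_append _ _ _ _).2 ⟨_, h3, hQ'⟩) rfl (fun h => hno ?_) (by rw [e]; exact hf.1) (by rw [e]; exact hf.2)
      convert h using 1; simp [hlen]; ring
    have hlL : L.length = 2 * (p + 1) := by simp at hL; omega
    obtain ⟨Q1, hQ1⟩ := Multiset.exists_cons_of_mem ha
    rw [← Multiset.singleton_add] at hQ1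
    rcases tri2 hN (hf.of_add (C := Q1 + fl L) (by rw [hQ1]; abel)) hW with ⟨c, o, hc, ht⟩ | hV
    · obtain ⟨cs, a', F, L', r1, r2, r3, r4, r5, r6⟩ := ih x7 e x7 L (Q0 ++ [(x2, x3, x4), (x5, x6, x7)])
        (Q0 ++ [(x2, x3, x4), (x5, x6, x7)]) hlL h3 ((Pth_append _ _ _ _).2 ⟨_, hQ, h1, h2, rfl⟩)
        ((Pth_append _ _ _ _).2 ⟨_, hQ, h1, h2, rfl⟩) rfl rfl (by convert hf using 1; simp only [fl_append, fl]; abel)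
        (by simp [fl_append, fl]) hW (by convert hno using 2; simp; ring)
      refine ⟨c :: cs, a', {o} + F, (x2, x3, x4) :: (x5, x6, x7) :: L', by simp [r1], ?_, ⟨h1, h2, r3⟩, by simp [r4], by simp [fl, r5], ?_⟩
      · intro d hd; rcases List.mem_cons.1 hd with rfl | hd; exacts [ht, r2 _ hd]
      · rw [vss_cons]; simp only [fl]
        calc _ = (c.vs + {o}) + (vss cs + {a'} + F) := by abel
          _ = _ := by rw [hc, r6]; abel
    · obtain ⟨c, hc, hX, hY⟩ := hV x6 x2 x3 x4 x5 (by abel)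
      have h2' : col {x4, x5, x7, x6} = true := by
        rw [← h2]; congr 1; ext; simp only [Finset.mem_insert, Finset.mem_singleton]; tauto
      obtain ⟨cs, a', F, L', r1, r2, r3, r4, r5, r6⟩ := ih x7 e x6 L (Q0 ++ [(x2, x3, x4), (x5, x6, x7)])
        (Q0 ++ [(x2, x3, x4), (x5, x7, x6)]) hlL h3 ((Pth_append _ _ _ _).2 ⟨_, hQ, h1, h2, rfl⟩)
        ((Pth_append _ _ _ _).2 ⟨_, hQ, h1, h2', rfl⟩) (by simp only [fl_append, fl]; abel) (by simp) (by convert hf using 1; simp only [fl_append, fl]; abel)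
        (by simp [fl_append, fl]) hW (by convert hno using 2; simp; ring)
      refine ⟨c :: cs, a', {a} + F, (x2, x3, x4) :: (x5, x6, x7) :: L', by simp [r1], ?_, ⟨h1, h2, r3⟩, by simp [r4], by simp [fl, r5], ?_⟩
      · intro d hd; rcases List.mem_cons.1 hd with rfl | hd; exacts [Or.inl ⟨by rw [hX]; simp, by rw [hY]; simp⟩, r2 _ hd]
      · rw [vss_cons]; simp only [fl]
        calc _ = (c.vs) + (vss cs + {a'} + F) + {a} := by abel
          _ = (c.vs + {x6}) + fl L + {a} := by rw [r6]; abel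
          _ = _ := by rw [hc]; abel
end Chain


section Odd
variable {V : Type*} [DecidableEq V] {col : Finset V → Bool} {W : Finset V}

lemma odd_close (c : Cfg V) (cs : List (Cfg V)) (l l' : List V) (x y z z' a u3 u4 : V)
    (hf : Fr W (vss (c :: cs) + {a} + {u3} + {u4}))
    (hm : Mid col W c cs l) (hm' : Mid col W c cs l')
    (hl : ∀ w ∈ l, w ∈ W) (hl' : ∀ w ∈ l', w ∈ W)
    (hn : (x :: y :: l).Nodup) (hn' : (z :: z' :: y :: l').Nodup) (hxz : x ≠ z) (hxz' : x ≠ z')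
    (hx : x ∈ W) (hy : y ∈ W) (hz : z ∈ W) (hz' : z' ∈ W)
    (hxX : x ∉ c.X col W) (hzX : z ∉ c.X col W) (hyY : y ∉ (lastC c cs).Y col W)
    (hred : ∀ x y z z', x ∈ W → y ∈ W → z ∈ W → z' ∈ W → [x, y, z, z'].Nodup → col {a, u3, x, y} = true →
      col {y, z, z', u4} = true → False) :
    HC col false (2 * (cs.length + 1) + 1) := by
  by_cases h1 : col {a, u3, x, y} = true
  · by_cases h2 : col {y, z, z', u4} = true
    · exact (hred x y z z' hx hy hz hz' (by simp at hn hn' ⊢; grind) h1 h2).elim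
    · obtain ⟨B, b1, b2, b3⟩ := blue_path c cs l' z y hm' hz hzX hl' hy hyY
      refine HC_of (L' := [(u4, z', z)]) b1 ⟨?_, rfl⟩ (by simp [b2]) ?_
      · simp only [Bool.not_eq_true] at h2
        rw [← h2]; congr 1; ext; simp only [Finset.mem_insert, Finset.mem_singleton]; tauto
      · have := (hf.of_add (A := vss (c :: cs) + {u4}) (C := {a} + {u3}) (by abel)).add_list hn' (by simp; exact ⟨hz, hz', hy, hl'⟩)
        convert this using 1
        simp only [b3, fl, ← Multiset.cons_coe, ← Multiset.singleton_add]; abel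
  · obtain ⟨B, b1, b2, b3⟩ := blue_path c cs l x y hm hx hxX hl hy hyY
    refine HC_of (L' := [(a, u3, x)]) b1 ⟨?_, rfl⟩ (by simp [b2]) ?_
    · simp only [Bool.not_eq_true] at h1
      rw [← h1]; congr 1; ext; simp only [Finset.mem_insert, Finset.mem_singleton]; tauto
    · have := (hf.of_add (A := vss (c :: cs) + {a} + {u3}) (C := {u4}) (by abel)).add_list hn (by simp; exact ⟨hx, hy, hl⟩)
      convert this using 1
      simp only [b3, fl, ← Multiset.cons_coe, ← Multiset.singleton_add]; abel

lemma odd_fin (p : ℕ) (cs : List (Cfg V)) (a u3 u4 : V) (hlen : cs.length = p + 1)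
    (hf : Fr W (vss cs + {a} + {u3} + {u4})) (hty : ∀ c ∈ cs, TyH col W c) (hW : p + 4 ≤ W.card)
    (hred : ∀ x y z z', x ∈ W → y ∈ W → z ∈ W → z' ∈ W → [x, y, z, z'].Nodup → col {a, u3, x, y} = true →
      col {y, z, z', u4} = true → False) :
    HC col false (2 * (p + 1) + 1) := by
  by_cases hS : ∃ c ∈ cs, Sm col W c
  · obtain ⟨c, hc, hSc⟩ := hS
    obtain ⟨s, t, rfl⟩ := List.append_of_mem hc
    have hp : (s ++ c :: t).Perm (c :: (s ++ t)) := List.perm_middle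
    rw [vss_perm hp] at hf
    have hl2 : (s ++ t).length = p := by simp at hlen ⊢; omega
    have h2 : ∀ d ∈ c :: (s ++ t), Le2 col W d := fun d hd => (hty d (hp.mem_iff.2 hd)).ty.le2
    generalize s ++ t = cs at *
    clear hp hty hlen hc
    obtain ⟨l, l1, l2, l3, l4, l5⟩ := fill c cs (∅ : Finset V) h2 (by simp; omega)
    obtain ⟨y, y1, y2, y3, y4⟩ := pick2 (W := W) (F := ∅) (G := (lastC c cs).Y col W) (l := l) (k1 := 0)
      (by simp) (h2 _ (lastC_mem _ _)).2 (by omega)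
    obtain ⟨x, x1, x2, x3, x4⟩ := pick2 (W := W) (F := ∅) (G := c.X col W) (l := y :: l) (k1 := 0)
      (by simp) hSc.1 (by simp; omega)
    obtain ⟨z, z1, z2, z3, z4⟩ := pick2 (W := W) (F := ∅) (G := c.X col W) (l := x :: y :: l) (k1 := 0)
      (by simp) hSc.1 (by simp; omega)
    obtain ⟨v, v1, v2, v3, v4⟩ := pick2 (W := W) (F := ∅) (G := ∅) (l := z :: x :: y :: l) (k1 := 0) (k2 := 0)
      (by simp) (by simp) (by simp; omega)
    rw [← hl2]
    simp only [List.mem_cons, not_or] at x4 z4 v4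
    refine odd_close c cs l l x y z v a u3 u4 hf l5 l5 l3 l3 ?_ ?_ (Ne.symm z4.1) (Ne.symm v4.2.1) x1 y1 z1 v1 x3 z3 y3 hred
    · simp only [List.nodup_cons, List.mem_cons, not_or]; grind
    · simp only [List.nodup_cons, List.mem_cons, not_or]; grind
  push Not at hS
  have hT : ∀ c ∈ cs, IsT col W c := fun c hc => ((hty c hc).resolve_left (hS c hc)).1
  obtain ⟨c, cs, rfl⟩ := List.exists_cons_of_length_eq_add_one hlen
  have hlen : cs.length = p := by simpa using hlen
  rcases Nat.eq_zero_or_pos p with rfl | hp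
  · exact ((hty c (by simp)).resolve_left (hS c (by simp))).2
  have hc := hT c (by simp)
  by_cases hD : ∀ e ∈ cs, e.X col W = c.X col W
  · have hsub : ∀ e ∈ c :: cs, e.X col W ⊆ c.X col W ∧ e.Y col W ⊆ c.X col W := by
      intro e he
      have h1 := hT e he
      have h2 : e.X col W = c.X col W := by
        rcases List.mem_cons.1 he with rfl | he; exacts [rfl, hD e he]
      rw [h1.2, h2]; exact ⟨subset_rfl, subset_rfl⟩
    obtain ⟨l, l1, l2, l3, l4⟩ := get_list (W := W) (c.X col W) (p + 2) (by rw [hc.1]; omega)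
    obtain ⟨x, l, rfl⟩ := List.exists_cons_of_length_eq_add_one l2
    obtain ⟨y, l, rfl⟩ := List.exists_cons_of_length_eq_add_one (l := l) (n := p) (by simpa using l2)
    obtain ⟨z, l, rfl⟩ := List.exists_cons_of_length_eq_add_one (l := l) (n := p - 1) (by simp at l2; omega)
    obtain ⟨v, hv⟩ := Finset.card_pos.1 (by rw [hc.1]; omega : 0 < (c.X col W).card)
    simp only [List.mem_cons, forall_eq_or_imp] at l3 l4
    simp only [List.nodup_cons, List.mem_cons, not_or] at l1
    have hll : l.length + 1 = p := by simp at l2; omega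
    have e : c.X col W ⊆ c.X col W := subset_rfl
    have hmem : ∀ w, w ∉ c.X col W → v ≠ w := by rintro w hw rfl; exact hw hv
    rw [← hlen]
    refine odd_close c cs (z :: l) (x :: l) x y z v a u3 u4 hf (mid_same _ c cs _ hsub ?_ ?_) (mid_same _ c cs _ hsub ?_ ?_) ?_ ?_ ?_ ?_ ?_ ?_ l3.1 l3.2.1 l3.2.2.1 (X_sub c hv) l4.1 l4.2.2.1 ?_ hred
    · simp only [List.mem_cons, forall_eq_or_imp]; tauto
    · simp; omega
    · simp only [List.mem_cons, forall_eq_or_imp]; tauto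
    · simp; omega
    · simp only [List.mem_cons, forall_eq_or_imp]; tauto
    · simp only [List.mem_cons, forall_eq_or_imp]; tauto
    · simp only [List.nodup_cons, List.mem_cons, not_or]; grind
    · simp only [List.nodup_cons, List.mem_cons, not_or]
      have := hmem x l4.1; have := hmem y l4.2.1; have := hmem z l4.2.2.1
      have : v ∉ l := fun h => l4.2.2.2 v h hv
      grind
    · grind
    · exact (hmem x l4.1).symm
    · exact fun h => l4.2.1 ((hsub _ (lastC_mem c cs)).2 h)
  · push Not at hD
    obtain ⟨d, hd, hne⟩ := hD
    obtain ⟨s, t, rfl⟩ := List.append_of_mem hd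
    have hp : (c :: (s ++ d :: t)).Perm (c :: ((s ++ t) ++ [d])) :=
      (List.perm_middle.trans (List.perm_append_singleton d (s ++ t)).symm).cons _
    rw [vss_perm hp] at hf
    have hl2 : ((s ++ t) ++ [d]).length = p := by simp at hlen ⊢; omega
    have h2 : ∀ e ∈ c :: ((s ++ t) ++ [d]), Le2 col W e := fun e he => (hty e (hp.mem_iff.2 he)).ty.le2
    have hla : lastC c ((s ++ t) ++ [d]) = d := lastC_append _ _ _
    have hdT := hT d (by simp)
    generalize (s ++ t) ++ [d] = cs at *
    clear hp hty hlen hS hT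
    obtain ⟨y, hy1, hy2⟩ : ∃ y ∈ c.X col W, y ∉ d.X col W := by
      by_contra hcon; push Not at hcon
      exact hne (Finset.eq_of_subset_of_card_le hcon (by rw [hc.1, hdT.1])).symm
    cases cs with
    | nil => simp at hl2; omega
    | cons e ds =>
      obtain ⟨l, l1, l2, l3, l4, l5⟩ := fill e ds {y} (fun d hd => h2 d (List.mem_cons_of_mem _ hd)) (by simp at *; omega)
      obtain ⟨w, w1, w2, w3, w4⟩ := pick2 (W := W) (F := c.Y col W) (G := e.X col W) (l := l)
        hc.le2.2 (h2 e (by simp)).1 (by simp at *; omega)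
      obtain ⟨x, x1, x2, x3, x4⟩ := pick2 (W := W) (F := ∅) (G := c.X col W) (l := w :: l) (k1 := 0)
        (by simp) hc.le2.1 (by simp at *; omega)
      obtain ⟨z, z1, z2, z3, z4⟩ := pick2 (W := W) (F := ∅) (G := c.X col W) (l := x :: w :: l) (k1 := 0)
        (by simp) hc.le2.1 (by simp at *; omega)
      obtain ⟨v, v1, v2, v3, v4⟩ := pick2 (W := W) (F := ∅) (G := ∅) (l := y :: z :: x :: w :: l) (k1 := 0) (k2 := 0)
        (by simp) (by simp) (by simp at *; omega)
      have hyl : y ∉ l := fun h => l4 y h (by simp)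
      have hyw : y ≠ w := by rintro rfl; rw [hc.2] at w2; exact w2 hy1
      have hyx : y ≠ x := by rintro rfl; exact x3 hy1
      have hyz : y ≠ z := by rintro rfl; exact z3 hy1
      simp only [List.mem_cons, not_or] at x4 z4 v4
      rw [← hl2]
      refine odd_close c (e :: ds) (w :: l) (w :: l) x y z v a u3 u4 hf ⟨w2, w3, l5⟩ ⟨w2, w3, l5⟩ (by simp; exact ⟨w1, l3⟩) (by simp; exact ⟨w1, l3⟩) ?_ ?_ (Ne.symm z4.1) (Ne.symm v4.2.2.1) x1 (X_sub c hy1) z1 v1 x3 z3 (by rw [hla, hdT.2]; exact hy2) hred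
      · simp only [List.nodup_cons, List.mem_cons, not_or]; grind
      · simp only [List.nodup_cons, List.mem_cons, not_or]; grind
end Odd


section Odd2
variable {V : Type*} [DecidableEq V] {col : Finset V → Bool} {W : Finset V}

lemma Pth_end_mem {b : Bool} {u v : V} {L : List (V × V × V)} (h : Pth col b u L v) (hL : L ≠ []) : v ∈ fl L := by
  induction L generalizing u with
  | nil => exact (hL rfl).elim
  | cons t L ih =>
    obtain ⟨x, y, z⟩ := t
    cases L with
    | nil => have := h.2; simp only [Pth] at this; simp [fl, this]
    | cons t L => have := ih h.2 (by simp); rw [fl]; exact Multiset.mem_add.2 (Or.inr this)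

lemma split_path {b : Bool} {u v : V} {L : List (V × V × V)} (h : Pth col b u L v) (k : ℕ) (hk : k ≤ L.length) :
    ∃ L1 L2 w, L = L1 ++ L2 ∧ L1.length = k ∧ Pth col b u L1 w ∧ Pth col b w L2 v := by
  rw [← List.take_append_drop k L, Pth_append] at h
  obtain ⟨w, h1, h2⟩ := h
  exact ⟨_, _, w, (List.take_append_drop k L).symm, by simpa using hk, h1, h2⟩

lemma ela_odd (p : ℕ) (J : V) (L : List (V × V × V)) (hL : Pth col true J L J) (hf : Fr W (fl L))
    (hp : 2 * (p + 1) + 1 ≤ L.length) (hW : p + 4 ≤ W.card) (hno : ¬ HC col true (L.length + 1)) :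
    HC col false (2 * (p + 1) + 1) := by
  obtain ⟨L1, L2, u1, rfl, hlen, h1, h2⟩ := split_path hL (2 * (p + 1)) (by omega)
  cases L2 with
  | nil => simp at hp; omega
  | cons t R =>
  obtain ⟨u2, u3, u4⟩ := t
  obtain ⟨h2, h3⟩ := h2
  rw [fl_append, fl] at hf
  have main : ∃ (cs : List (Cfg V)) (a' : V) (F : Multiset V) (L' : List (V × V × V)) (a : V), cs.length = p + 1 ∧
      (∀ c ∈ cs, TyH col W c) ∧ Pth col true J L' a' ∧ L'.length = L1.length ∧ fl L' = fl L1 ∧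
      vss cs + {a'} + F = {a} + fl L1 ∧ Fr W ({a} + fl L1 + {u3} + {u4}) := by
    by_cases hR : R = []
    · subst hR
      simp only [Pth] at h3; subst h3
      obtain ⟨cs, a', F, L', r1, r2, r3, r4, r5, r6⟩ := chain (W := W) p u4 u1 u2 L1 [(u2, u3, u4)] [(u3, u4, u2)]
        hlen h1 ⟨h2, rfl⟩ ⟨by rw [← h2]; congr 1; ext; simp only [Finset.mem_insert, Finset.mem_singleton]; tauto, rfl⟩
        (by simp only [fl]; abel) rfl (by exact hf) (by simp [fl]) (by omega) (by convert hno using 2; simp)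
      exact ⟨cs, a', F, L', u2, r1, r2, r3, r4, r5, r6, hf.of_add (C := 0) (by simp only [fl]; abel)⟩
    · have hJ := Pth_end_mem h3 hR
      obtain ⟨R1, hR1⟩ := Multiset.exists_cons_of_mem hJ
      rw [← Multiset.singleton_add] at hR1
      have hQ : Pth col true u1 ((u2, u3, u4) :: R) J := ⟨h2, h3⟩
      obtain ⟨cs, a', F, L', r1, r2, r3, r4, r5, r6⟩ := chain (W := W) p J u1 J L1 ((u2, u3, u4) :: R) ((u2, u3, u4) :: R)
        hlen h1 hQ hQ rfl rfl (by exact hf) (by simp [fl, hJ]) (by omega) (by convert hno using 2; simp)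
      exact ⟨cs, a', F, L', J, r1, r2, r3, r4, r5, r6, hf.of_add (C := R1 + {u2}) (by rw [hR1]; abel)⟩
  obtain ⟨cs, a', F, L', a, r1, r2, r3, r4, r5, r6, r7⟩ := main
  refine odd_fin p cs a' u3 u4 r1 (r7.of_add (C := F) ?_) r2 hW ?_
  · rw [← r6]; abel
  · intro x y z z' hx hy hz hz' hn e1 e2
    apply hno
    refine HC_of (u := u4) (L := R ++ L') (L' := [(u3, x, y), (z, z', u4)]) ((Pth_append _ _ _ _).2 ⟨J, h3, r3⟩) ⟨e1, e2, rfl⟩ ?_ ?_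
    · simp [r4]; omega
    · have := (hf.of_add (A := fl R + fl L1 + {u3} + {u4}) (C := {u2}) (by abel)).add_list hn (by simp [hx, hy, hz, hz'])
      convert this using 1
      simp only [fl_append, r5, fl, ← Multiset.cons_coe, ← Multiset.singleton_add, Multiset.coe_nil]; abel
end Odd2


section ELB
variable {V : Type*} [DecidableEq V] {col : Finset V → Bool} {W : Finset V}

def Red2 (col : Finset V → Bool) (W : Finset V) (t s : V) : Prop :=
  ∀ p q r p' q', [p, q, r, p', q'].Nodup → (∀ w ∈ [p, q, r, p', q'], w ∈ W) → col {t, p, q, r} = true →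
    col {r, p', q', s} = true → False

lemma red2_of {t s : V} {R : List (V × V × V)} {k : ℕ} (hR : Pth col true s R t) (hf : Fr W (fl R + {s}))
    (hno : ¬ HC col true k) (hk : R.length + 2 = k) : Red2 col W t s := by
  intro p q r p' q' hn hw h1 h2
  apply hno
  refine HC_of (L := R) (L' := [(p, q, r), (p', q', s)]) hR ⟨h1, h2, rfl⟩ (by simpa using hk) ?_
  have := hf.add_list hn hw
  convert this using 1
  simp only [fl, ← Multiset.cons_coe, ← Multiset.singleton_add, Multiset.coe_nil]; abel

lemma closure2 {t s x y : V} {E : List V} (hr : Red2 col W t s) (hE : E.length = 5)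
    (hn : (x :: y :: E).Nodup) (hw : ∀ w ∈ x :: y :: E, w ∈ W) :
    ∃ u w1 w2 w3 w4, (u = t ∨ u = s) ∧ [w1, w2, w3, w4].Nodup ∧ (∀ w ∈ [w1, w2, w3, w4], w ∈ E) ∧
      Pth col false x [(w1, w2, u), (w3, w4, y)] y := by
  have sym : ∀ a b c d : V, ({a, b, c, d} : Finset V) = {d, c, b, a} := by
    intro a b c d; ext; simp only [Finset.mem_insert, Finset.mem_singleton]; tauto
  have aux : ∀ x y p q r1 r2 r3, [x, y, p, q, r1, r2, r3].Nodup → (∀ w ∈ [x, y, p, q, r1, r2, r3], w ∈ W) →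
      col {x, p, q, t} = true → col {x, r1, r2, s} = false ∧ col {s, p, r3, y} = false := by
    intro x y p q r1 r2 r3 hn hw h1
    constructor
    · by_contra hc
      simp only [Bool.not_eq_false] at hc
      refine hr p q x r1 r2 ?_ ?_ ?_ hc
      · simp at hn ⊢; grind
      · simp at hw ⊢; tauto
      · rw [← h1]; congr 1; ext; simp only [Finset.mem_insert, Finset.mem_singleton]; tauto
    · by_contra hc
      simp only [Bool.not_eq_false] at hc
      refine hr x q p r3 y ?_ ?_ ?_ ?_
      · simp at hn ⊢; grind
      · simp at hw ⊢; tauto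
      · rw [← h1]; congr 1; ext; simp only [Finset.mem_insert, Finset.mem_singleton]; tauto
      · rw [← hc]; congr 1; ext; simp only [Finset.mem_insert, Finset.mem_singleton]; tauto
  obtain ⟨e1, e2, e3, e4, e5, rfl⟩ : ∃ e1 e2 e3 e4 e5, E = [e1, e2, e3, e4, e5] := by
    match E, hE with
    | [a, b, c, d, e], _ => exact ⟨a, b, c, d, e, rfl⟩
  by_cases h1 : col {x, e1, e2, t} = true
  · obtain ⟨a1, a2⟩ := aux x y e1 e2 e3 e4 e5 hn hw h1
    exact ⟨s, e3, e4, e1, e5, Or.inr rfl, by simp at hn ⊢; grind, by simp, a1, a2, rfl⟩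
  by_cases h2 : col {y, e3, e4, t} = true
  · obtain ⟨a1, a2⟩ := aux y x e3 e4 e1 e2 e5 (by simp at hn ⊢; grind) (by simp at hw ⊢; tauto) h2
    refine ⟨s, e5, e3, e1, e2, Or.inr rfl, by simp at hn ⊢; grind, by simp, ?_, ?_, rfl⟩
    · rw [← a2]; congr 1; ext; simp only [Finset.mem_insert, Finset.mem_singleton]; tauto
    · rw [← a1]; congr 1; ext; simp only [Finset.mem_insert, Finset.mem_singleton]; tauto
  simp only [Bool.not_eq_true] at h1 h2
  refine ⟨t, e1, e2, e3, e4, Or.inl rfl, by simp at hn ⊢; grind, by simp, h1, ?_, rfl⟩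
  rw [← h2]; congr 1; ext; simp only [Finset.mem_insert, Finset.mem_singleton]; tauto

lemma close_cyc {t s x y : V} {E l : List V} {B : List (V × V × V)} {A : Multiset V} (hr : Red2 col W t s)
    (hB : Pth col false x B y) (hfl : fl B = A + (l : Multiset V) + {y})
    (ht : Fr W (A + {t})) (hs : Fr W (A + {s})) (hE : E.length = 5)
    (hn : (x :: y :: (E ++ l)).Nodup) (hw : ∀ w ∈ x :: y :: (E ++ l), w ∈ W) : HC col false (B.length + 2) := by
  have hn1 : (x :: y :: E).Nodup := hn.sublist (by simp)
  obtain ⟨u, w1, w2, w3, w4, hu, hwn, hwE, hp⟩ := closure2 (x := y) (y := x) hr hE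
    (by simp only [List.nodup_cons, List.mem_cons, not_or] at hn1 ⊢; grind) (fun w hw' => hw w (by simp at hw' ⊢; tauto))
  have hu : Fr W (A + {u}) := by rcases hu with rfl | rfl; exacts [ht, hs]
  refine HC_of hB hp rfl ?_
  have := hu.add_list (l := x :: y :: ([w1, w2, w3, w4] ++ l)) ?_ ?_
  · convert this using 1
    simp only [hfl, fl, ← Multiset.cons_coe, ← Multiset.singleton_add, List.cons_append, List.nil_append]; abel
  · have hd : List.Disjoint E l := by
      have := (List.nodup_cons.1 (List.nodup_cons.1 hn).2).2
      exact List.disjoint_of_nodup_append this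
    have hll : l.Nodup := hn.sublist (((List.sublist_append_right E l).cons y).cons x)
    have : (([w1, w2, w3, w4] ++ l)).Nodup := by
      refine List.Nodup.append hwn hll ?_
      intro w h1 h2; exact hd (hwE w h1) h2
    have hx : x ∉ y :: (E ++ l) := (List.nodup_cons.1 hn).1
    have hy : y ∉ (E ++ l) := (List.nodup_cons.1 (List.nodup_cons.1 hn).2).1
    simp only [List.mem_cons, List.mem_append, not_or] at hx hy
    refine List.nodup_cons.2 ⟨?_, List.nodup_cons.2 ⟨?_, this⟩⟩
    · rw [List.mem_cons, List.mem_append]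
      rintro (h | h | h)
      exacts [hx.1 h, hx.2.1 (hwE _ h), hx.2.2 h]
    · rw [List.mem_append]
      rintro (h | h)
      exacts [hy.1 (hwE _ h), hy.2 h]
  · intro w h
    rw [List.mem_cons, List.mem_cons, List.mem_append] at h
    rcases h with h | h | h | h
    · exact hw w (by simp [h])
    · exact hw w (by simp [h])
    · exact hw w (by simp [hwE w h])
    · exact hw w (by simp [h])

/-- blue path through a list of configurations with leftover -/
lemma path_left (q k : ℕ) (cs : List (Cfg V)) (hlen : cs.length = q + 1) (hty : ∀ c ∈ cs, TyH col W c)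
    (hk : 2 ≤ k) (hW : q + k + 2 ≤ W.card) : ∃ (x y : V) (l E : List V) (B : List (V × V × V)),
    Pth col false x B y ∧ B.length = 2 * (q + 1) ∧ fl B = vss cs + (l : Multiset V) + {y} ∧ E.length = k ∧
    (x :: y :: (E ++ l)).Nodup ∧ (∀ w ∈ x :: y :: (E ++ l), w ∈ W) := by
  obtain ⟨c, cs, rfl⟩ := List.exists_cons_of_length_eq_add_one hlen
  have h2 : ∀ d ∈ c :: cs, Le2 col W d := fun d hd => (hty d hd).ty.le2
  have hl : cs.length = q := by simpa using hlen
  obtain ⟨l, l1, l2, l3, l4, l5⟩ := fill c cs (∅ : Finset V) h2 (by simp; omega)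
  obtain ⟨y, y1, y2, y3, y4⟩ := pick2 (W := W) (F := ∅) (G := (lastC c cs).Y col W) (l := l) (k1 := 0)
      (by simp) (h2 _ (lastC_mem _ _)).2 (by omega)
  obtain ⟨x, x1, x2, x3, x4⟩ := pick2 (W := W) (F := ∅) (G := c.X col W) (l := y :: l) (k1 := 0)
      (by simp) (h2 c (by simp)).1 (by simp; omega)
  obtain ⟨E, E1, E2, E3, E4⟩ := get_list (W := W) (x :: y :: l).toFinset k (by
    have := List.toFinset_card_le (x :: y :: l); simp at this ⊢; omega)
  obtain ⟨B, b1, b2, b3⟩ := blue_path c cs l x y l5 x1 x3 l3 y1 y3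
  refine ⟨x, y, l, E, B, b1, by rw [b2, hl], b3, E2, ?_, ?_⟩
  · have e4 : ∀ w ∈ E, w ≠ x ∧ w ≠ y ∧ w ∉ l := fun w hw => by have := E4 w hw; simpa using this
    have hd : (E ++ l).Nodup := List.Nodup.append E1 l1 (fun w h1 h2 => (e4 w h1).2.2 h2)
    simp only [List.mem_cons, not_or] at x4
    refine List.nodup_cons.2 ⟨?_, List.nodup_cons.2 ⟨?_, hd⟩⟩
    · rw [List.mem_cons, List.mem_append]
      rintro (h | h | h)
      exacts [x4.1 h, (e4 x h).1 rfl, x4.2 h]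
    · rw [List.mem_append]
      rintro (h | h)
      exacts [(e4 y h).2.1 rfl, y4 h]
  · intro w h
    rw [List.mem_cons, List.mem_cons, List.mem_append] at h
    rcases h with rfl | rfl | h | h
    exacts [x1, y1, E3 w h, l3 w h]
end ELB


section ELB2
variable {V : Type*} [DecidableEq V] {col : Finset V → Bool} {W : Finset V}

lemma elb3 (u : V) (L : List (V × V × V)) (hL : Pth col true u L u) (hlen : L.length = 2) (hf : Fr W (fl L))
    (hW : 7 ≤ W.card) (hno : ¬ HC col true 3) : HC col false 3 := by
  obtain ⟨⟨u2, u3, u4⟩, ⟨u5, u6, u1⟩, rfl⟩ := List.length_eq_two.1 hlen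
  simp only [Pth] at hL
  obtain ⟨h1, h2, rfl⟩ := hL
  simp only [fl] at hf
  have hr : Red2 col W u1 u4 := red2_of (R := [(u5, u6, u1)]) ⟨h2, rfl⟩
    (hf.of_add (C := {u2} + {u3}) (by simp only [fl]; abel)) hno rfl
  have key : ∀ (v v' : V) (C : Multiset V), {v} + {v'} + {u1} + {u4} + C = ({u2} + {u3} + {u4} + ({u5} + {u6} + {u1} + 0)) →
      HC col false 3 ∨ ∀ x x', x ∈ W → x' ∈ W → x ≠ x' → col {v, x, x', v'} = true := by
    intro v v' C hC
    by_cases hb : ∀ x x', x ∈ W → x' ∈ W → x ≠ x' → col {v, x, x', v'} = true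
    · exact Or.inr hb
    left
    push Not at hb
    obtain ⟨x, x', hx, hx', hne, hcol⟩ := hb
    simp only [ne_eq, Bool.not_eq_true] at hcol
    obtain ⟨E, E1, E2, E3, E4⟩ := get_list (W := W) {x, x'} 5 (by rw [Finset.card_pair hne]; omega)
    refine close_cyc (x := x) (y := x') (E := E) (l := []) (B := [(v, v', x')]) (A := {v} + {v'}) hr ⟨?_, rfl⟩ ?_ ?_ ?_ E2 ?_ ?_
    · rw [← hcol]; congr 1; ext; simp only [Finset.mem_insert, Finset.mem_singleton]; tauto
    · simp only [fl, Multiset.coe_nil]; abel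
    · exact hf.of_add (C := C + {u4}) (by rw [← hC]; abel)
    · exact hf.of_add (C := C + {u1}) (by rw [← hC]; abel)
    · have e4 : ∀ w ∈ E, w ≠ x ∧ w ≠ x' := fun w hw => by have := E4 w hw; simpa using this
      rw [List.append_nil]
      refine List.nodup_cons.2 ⟨?_, List.nodup_cons.2 ⟨?_, E1⟩⟩
      · rw [List.mem_cons]; rintro (h | h); exacts [hne h, (e4 x h).1 rfl]
      · intro h; exact (e4 x' h).2 rfl
    · intro w h
      rw [List.append_nil, List.mem_cons, List.mem_cons] at h
      rcases h with rfl | rfl | h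
      exacts [hx, hx', E3 w h]
  rcases key u2 u3 ({u5} + {u6}) (by abel) with h | k1
  · exact h
  rcases key u3 u5 ({u2} + {u6}) (by abel) with h | k2
  · exact h
  rcases key u5 u2 ({u3} + {u6}) (by abel) with h | k3
  · exact h
  exfalso; apply hno
  obtain ⟨E, E1, E2, E3, E4⟩ := get_list (W := W) ∅ 6 (by simp; omega)
  match E, E1, E2, E3 with
  | [x1, x2, x3, x4, x5, x6], E1, E2, E3 =>
    have E3' := E3
    have E1' := E1
    simp at E3 E1
    refine ⟨u2, [(x1, x2, u3), (x3, x4, u5), (x5, x6, u2)], ⟨k1 x1 x2 (by tauto) (by tauto) (by tauto),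
      k2 x3 x4 (by tauto) (by tauto) (by tauto), k3 x5 x6 (by tauto) (by tauto) (by tauto), rfl⟩, rfl, ?_⟩
    have := (hf.of_add (A := {u2} + {u3} + {u5}) (C := {u1} + {u4} + {u6}) (by abel)).add_list E1' E3'
    convert this using 1
    simp only [fl, ← Multiset.cons_coe, ← Multiset.singleton_add, Multiset.coe_nil]; abel

lemma elb_even (q : ℕ) (u : V) (L : List (V × V × V)) (hL : Pth col true u L u) (hlen : L.length = 2 * (q + 1) + 1)
    (hf : Fr W (fl L)) (hW : q + 7 ≤ W.card) (hno : ¬ HC col true (2 * (q + 1) + 2)) : HC col false (2 * (q + 1) + 2) := by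
  obtain ⟨L1, L2, u1, rfl, hlen1, h1, h2⟩ := split_path hL (2 * (q + 1)) (by omega)
  have : L2.length = 1 := by simp at hlen; omega
  obtain ⟨⟨u2, u3, u4⟩, rfl⟩ := List.length_eq_one_iff.1 this
  simp only [Pth] at h2
  obtain ⟨h2, rfl⟩ := h2
  rw [fl_append, fl, fl] at hf
  obtain ⟨cs, a', F, L', r1, r2, r3, r4, r5, r6⟩ := chain (W := W) q u4 u1 u2 L1 [(u2, u3, u4)] [(u3, u4, u2)]
        hlen1 h1 ⟨h2, rfl⟩ ⟨by rw [← h2]; congr 1; ext; simp only [Finset.mem_insert, Finset.mem_singleton]; tauto, rfl⟩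
        (by simp only [fl]; abel) rfl (by exact hf) (by simp [fl]) (by omega) (by convert hno using 2; simp [hlen1])
  have hr : Red2 col W a' u4 := red2_of r3 (hf.of_add (C := {u2} + {u3}) (by rw [r5]; abel)) hno (by omega)
  obtain ⟨x, y, l, E, B, b1, b2, b3, b4, b5, b6⟩ := path_left q 5 cs r1 r2 (by omega) hW
  rw [← b2]
  refine close_cyc hr b1 b3 ?_ ?_ b4 b5 b6
  · refine hf.of_add (C := F + {u3} + {u4}) ?_
    calc _ = (vss cs + {a'} + F) + {u3} + {u4} := by abel
      _ = _ := by rw [r6]; abel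
  · refine hf.of_add (C := {a'} + F + {u3}) ?_
    calc _ = (vss cs + {a'} + F) + {u3} + {u4} := by abel
      _ = _ := by rw [r6]; abel

lemma elb_odd (q : ℕ) (u : V) (L : List (V × V × V)) (hL : Pth col true u L u) (hlen : L.length = 2 * (q + 1) + 2)
    (hf : Fr W (fl L)) (hW : q + 8 ≤ W.card) (hno : ¬ HC col true (2 * (q + 1) + 3)) : HC col false (2 * (q + 1) + 3) := by
  obtain ⟨L1, L2, u1, rfl, hlen1, h1, h2⟩ := split_path hL (2 * (q + 1)) (by omega)
  have : L2.length = 2 := by simp at hlen; omega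
  obtain ⟨⟨u2, u3, u4⟩, ⟨u5, u6, u7⟩, rfl⟩ := List.length_eq_two.1 this
  simp only [Pth] at h2
  obtain ⟨h2, h3, rfl⟩ := h2
  rw [fl_append, fl, fl, fl] at hf
  obtain ⟨cs, a', F, L', r1, r2, r3, r4, r5, r6⟩ := chain (W := W) q u7 u1 u6 L1 [(u2, u3, u4), (u5, u6, u7)] [(u2, u3, u4), (u5, u7, u6)]
        hlen1 h1 ⟨h2, h3, rfl⟩ ⟨h2, by rw [← h3]; congr 1; ext; simp only [Finset.mem_insert, Finset.mem_singleton]; tauto, rfl⟩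
        (by simp only [fl]; abel) rfl (by exact hf) (by simp [fl]) (by omega) (by convert hno using 2; simp [hlen1])
  have hr1 : Red2 col W u4 u7 := red2_of (R := L1 ++ [(u2, u3, u4)]) ((Pth_append _ _ _ _).2 ⟨_, h1, h2, rfl⟩)
    (hf.of_add (C := {u5} + {u6}) (by rw [fl_append]; simp only [fl]; abel)) hno (by simp; omega)
  have hr2 : Red2 col W a' u4 := red2_of (R := (u5, u6, u7) :: L') ⟨h3, r3⟩
    (hf.of_add (C := {u2} + {u3}) (by simp only [fl]; rw [r5]; abel)) hno (by simp; omega)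
  have hF : Fr W (vss cs + {a'} + {u2} + {u3} + {u4} + {u5} + {u7}) := by
    refine hf.of_add (C := F) ?_
    calc _ = (vss cs + {a'} + F) + {u2} + {u3} + {u4} + {u5} + {u7} := by abel
      _ = _ := by rw [r6]; abel
  obtain ⟨x, y, l, E, B, b1, b2, b3, b4, b5, b6⟩ := path_left q 6 cs r1 r2 (by omega) hW
  match E, b4 with
  | [e1, e2, e3, e4, e5, e6], _ =>
  by_cases c1 : col {a', u2, e1, x} = true
  swap
  · simp only [Bool.not_eq_true] at c1
    have : 2 * (q + 1) + 3 = ((a', u2, x) :: B).length + 2 := by simp [b2]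
    rw [this]
    refine close_cyc (x := e1) (y := y) (E := [e2, e3, e4, e5, e6]) (l := x :: l) (A := vss cs + {a'} + {u2}) hr1 ⟨?_, b1⟩ ?_ ?_ ?_ rfl ?_ ?_
    · rw [← c1]; congr 1; ext; simp only [Finset.mem_insert, Finset.mem_singleton]; tauto
    · simp only [fl, b3, ← Multiset.cons_coe, ← Multiset.singleton_add]; abel
    · exact hF.of_add (C := {u3} + {u5} + {u7}) (by abel)
    · exact hF.of_add (C := {u3} + {u5} + {u4}) (by abel)
    · simp at b5 ⊢; grind
    · simp at b6 ⊢; tauto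
  by_cases c2 : col {x, e2, u3, u5} = true
  swap
  · simp only [Bool.not_eq_true] at c2
    have : 2 * (q + 1) + 3 = ((u3, u5, x) :: B).length + 2 := by simp [b2]
    rw [this]
    refine close_cyc (x := e2) (y := y) (E := [e1, e3, e4, e5, e6]) (l := x :: l) (A := vss cs + {u3} + {u5}) hr1 ⟨?_, b1⟩ ?_ ?_ ?_ rfl ?_ ?_
    · rw [← c2]; congr 1; ext; simp only [Finset.mem_insert, Finset.mem_singleton]; tauto
    · simp only [fl, b3, ← Multiset.cons_coe, ← Multiset.singleton_add]; abel
    · exact hF.of_add (C := {a'} + {u2} + {u7}) (by abel)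
    · exact hF.of_add (C := {a'} + {u2} + {u4}) (by abel)
    · simp at b5 ⊢; grind
    · simp at b6 ⊢; tauto
  by_cases c3 : col {u5, y, e3, u7} = true
  swap
  · simp only [Bool.not_eq_true] at c3
    have : 2 * (q + 1) + 3 = (B ++ [(u5, u7, e3)]).length + 2 := by simp [b2]
    rw [this]
    refine close_cyc (x := x) (y := e3) (E := [e1, e2, e4, e5, e6]) (l := y :: l) (A := vss cs + {u5} + {u7}) hr2 ((Pth_append _ _ _ _).2 ⟨_, b1, ?_, rfl⟩) ?_ ?_ ?_ rfl ?_ ?_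
    · rw [← c3]; congr 1; ext; simp only [Finset.mem_insert, Finset.mem_singleton]; tauto
    · simp only [fl_append, fl, b3, ← Multiset.cons_coe, ← Multiset.singleton_add]; abel
    · exact hF.of_add (C := {u2} + {u3} + {u4}) (by abel)
    · exact hF.of_add (C := {u2} + {u3} + {a'}) (by abel)
    · simp at b5 ⊢; grind
    · simp at b6 ⊢; tauto
  exfalso; apply hno
  refine HC_of (L := L') (L' := [(u2, e1, x), (e2, u3, u5), (y, e3, u7)]) r3 ⟨c1, c2, c3, rfl⟩ (by simp; omega) ?_
  have := (hf.of_add (A := fl L1 + {u2} + {u3} + {u5} + {u7}) (C := {u4} + {u6}) (by abel)).add_list (l := [e1, x, e2, y, e3])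
    (by simp at b5 ⊢; grind) (by simp at b6 ⊢; tauto)
  convert this using 1
  simp only [r5, fl, ← Multiset.cons_coe, ← Multiset.singleton_add, Multiset.coe_nil]; abel
end ELB2


section Uniq
variable {V : Type*} [DecidableEq V]

def Pm (M : Multiset V) (x y z q k : V) : Prop := {x} + {y} + {z} + {q} + {k} = M

structure Abs (A : V → V → Finset V) (T : V → V → V → Finset V) (Lv : V → V → Prop) (M : Multiset V) : Prop where
  hA : ∀ x y, A x y = A y x
  t1 : ∀ x y z, T x y z = T y x z
  t2 : ∀ x y z, T x y z = T x z y
  l1 : ∀ x y, Lv x y → Lv y x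
  path : ∀ i p j q k, Pm M i p j q k → 2 ≤ (A i p).card → 2 ≤ (T p j q).card → Lv q k → T p j q = A i p
  nin : ∀ x y z q k, Pm M x y z q k → 2 ≤ (T x z q).card ∨ 2 ≤ (T y z k).card
  na : ∀ w x y z o, Pm M w x y z o → 2 ≤ (A w x).card ∨ 2 ≤ (A y z).card
  np : ∀ i p j q k, Pm M i p j q k → 2 ≤ (A i p).card ∨ 2 ≤ (T p j q).card
  nv : ∀ w x y z o, Pm M w x y z o → Lv w x ∨ Lv y z

variable {A : V → V → Finset V} {T : V → V → V → Finset V} {Lv : V → V → Prop} {M : Multiset V}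

lemma Abs.i0 (h : Abs A T Lv M) {x y z q k : V} (hp : Pm M x y z q k) (hl : Lv q k)
    (h1 : 2 ≤ (A x y).card) (h2 : 2 ≤ (A x z).card) (hne : A x y ≠ A x z) :
    ¬ 2 ≤ (T y z q).card ∧ ¬ 2 ≤ (T y z k).card ∧ ¬ 2 ≤ (A y z).card ∧
      T x z q = A x y ∧ T x y q = A x z := by
  have a1 : ¬ 2 ≤ (T y z q).card := by
    intro hb
    have e1 := h.path x y z q k hp h1 hb hl
    have e2 := h.path x z y q k (by unfold Pm at *; rw [← hp]; abel) h2 (by rwa [h.t1]) hl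
    rw [h.t1] at e2; exact hne (e1.symm.trans e2)
  have a2 : ¬ 2 ≤ (T y z k).card := by
    intro hb
    have e1 := h.path x y z k q (by unfold Pm at *; rw [← hp]; abel) h1 hb (h.l1 _ _ hl)
    have e2 := h.path x z y k q (by unfold Pm at *; rw [← hp]; abel) h2 (by rwa [h.t1]) (h.l1 _ _ hl)
    rw [h.t1] at e2; exact hne (e1.symm.trans e2)
  have b1 : 2 ≤ (T x y q).card := 
    (h.nin x z y q k (by unfold Pm at *; rw [← hp]; abel)).resolve_right (by rwa [h.t1])
  have b2 : 2 ≤ (T x z q).card := 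
    (h.nin x y z q k hp).resolve_right a2
  have e3 := h.path y x z q k (by unfold Pm at *; rw [← hp]; abel) (by rwa [h.hA]) b2 hl
  have e4 := h.path z x y q k (by unfold Pm at *; rw [← hp]; abel) (by rwa [h.hA]) b1 hl
  refine ⟨a1, a2, ?_, by rw [e3, h.hA], by rw [e4, h.hA]⟩
  intro hb
  have e1 := h.path z y x q k (by unfold Pm at *; rw [← hp]; abel) (by rwa [h.hA]) (by rwa [h.t1]) hl
  have e2 := h.path y z x q k (by unfold Pm at *; rw [← hp]; abel) hb (by rwa [h.t1]) hl
  apply hne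
  rw [h.hA x y, h.hA x z, ← e3, ← e4, h.t1 x z, h.t1 x y, e1, e2, h.hA]

lemma Abs.i1 (h : Abs A T Lv M) {x y z q k : V} (hp : Pm M x y z q k) (hl : Lv q k)
    (h1 : 2 ≤ (A x y).card) (h2 : 2 ≤ (A x z).card) (hne : A x y ≠ A x z) (hz : Lv z q) : False := by
  obtain ⟨a1, a2, a3, a4, a5⟩ := h.i0 hp hl h1 h2 hne
  have b1 : 2 ≤ (A x k).card := (h.na x k y z q (by unfold Pm at *; rw [← hp]; abel)).resolve_right a3
  have b2 := h.path k x y q z (by unfold Pm at *; rw [← hp]; abel) (by rwa [h.hA]) (by rwa [a5]) (h.l1 _ _ hz)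
  have e : A x k = A x z := by rw [h.hA x k, ← b2, a5]
  obtain ⟨c1, c2, c3, c4, c5⟩ := h.i0 (x := x) (y := y) (z := k) (q := z) (k := q) (by unfold Pm at *; rw [← hp]; abel) hz h1 b1 (by rwa [e])
  rcases h.np z y k q x (by unfold Pm at *; rw [← hp]; abel) with h3 | h3
  · rw [h.hA] at h3; exact a3 h3
  · exact c2 h3

lemma Abs.same (h : Abs A T Lv M) {x y z q k : V} (hp : Pm M x y z q k) (hl : Lv q k)
    (h1 : 2 ≤ (A x y).card) (h2 : 2 ≤ (A x z).card) : A x y = A x z := by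
  by_contra hne
  have n1 : ¬ Lv z q := fun hz => h.i1 hp hl h1 h2 hne hz
  have n2 : ¬ Lv y q := fun hz => h.i1 (x := x) (y := z) (z := y) (q := q) (k := k) (by unfold Pm at *; rw [← hp]; abel) hl h2 h1 (Ne.symm hne) hz
  have n3 : ¬ Lv z k := fun hz => h.i1 (x := x) (y := y) (z := z) (q := k) (k := q) (by unfold Pm at *; rw [← hp]; abel) (h.l1 _ _ hl) h1 h2 hne hz
  rcases h.nv y q z k x (by unfold Pm at *; rw [← hp]; abel) with h3 | h3
  · exact n2 h3
  · exact n3 h3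

/-- the colour pair attached to a live pair -/
def Cl (A : V → V → Finset V) (Lv : V → V → Prop) (M : Multiset V) (q k : V) (D : Finset V) : Prop :=
  Lv q k ∧ ∃ x y z, Pm M x y z q k ∧ 2 ≤ (A x y).card ∧ A x y = D

lemma Cl.symm (h : Abs A T Lv M) {q k : V} {D : Finset V} (hc : Cl A Lv M q k D) : Cl A Lv M k q D := by
  obtain ⟨hl, x, y, z, hp, h1, h2⟩ := hc
  exact ⟨h.l1 _ _ hl, x, y, z, by unfold Pm at *; rw [← hp]; abel, h1, h2⟩

lemma three_eq {x y z a b c : V} (h : ({x} + {y} + {z} : Multiset V) = {a} + {b} + {c}) :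
    (x = a ∧ ((y = b ∧ z = c) ∨ (y = c ∧ z = b))) ∨ (x = b ∧ ((y = a ∧ z = c) ∨ (y = c ∧ z = a))) ∨
    (x = c ∧ ((y = a ∧ z = b) ∨ (y = b ∧ z = a))) := by
  have two : ∀ {y z b c : V}, ({y} + {z} : Multiset V) = {b} + {c} → (y = b ∧ z = c) ∨ (y = c ∧ z = b) := by
    intro y z b c h
    have hy : y ∈ ({b} + {c} : Multiset V) := by rw [← h]; simp
    simp only [Multiset.mem_add, Multiset.mem_singleton] at hy
    rcases hy with rfl | rfl
    · left; exact ⟨rfl, by simpa using h⟩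
    · right
      have h' : ({y} + {z} : Multiset V) = {y} + {b} := h.trans (add_comm _ _)
      exact ⟨rfl, by simpa using h'⟩
  have hx : x ∈ ({a} + {b} + {c} : Multiset V) := by rw [← h]; simp
  simp only [Multiset.mem_add, Multiset.mem_singleton] at hx
  rw [add_assoc] at h
  rcases hx with (rfl | rfl) | rfl
  · left; refine ⟨rfl, two ?_⟩; rw [add_assoc] at h; exact add_left_cancel h
  · right; left; refine ⟨rfl, two ?_⟩
    have h' : ({x} + ({y} + {z}) : Multiset V) = {x} + ({a} + {c}) := h.trans (by abel)
    exact add_left_cancel h'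
  · right; right; refine ⟨rfl, two ?_⟩
    have h' : ({x} + ({y} + {z}) : Multiset V) = {x} + ({a} + {b}) := h.trans (by abel)
    exact add_left_cancel h'

/-- all big pairs in the complement of a live pair carry D -/
lemma Cl.all (h : Abs A T Lv M) {q k : V} {D : Finset V} (hc : Cl A Lv M q k D) {x y z : V} (hp : Pm M x y z q k)
    (hb : 2 ≤ (A x y).card) : A x y = D := by
  obtain ⟨hl, a, b, c, hp', h1, rfl⟩ := hc
  have e : ({x} + {y} + {z} : Multiset V) = {a} + {b} + {c} := by
    unfold Pm at hp hp'
    exact add_right_cancel (b := ({q} + {k} : Multiset V)) (by have := hp.trans hp'.symm; rw [← add_assoc, ← add_assoc]; exact this)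
  have h3 : ∀ {x y z}, Pm M x y z q k → 2 ≤ (A x y).card → 2 ≤ (A x z).card → A x y = A x z := fun hp a b => h.same hp hl a b
  rcases three_eq e with ⟨rfl, ⟨rfl, rfl⟩ | ⟨rfl, rfl⟩⟩ | ⟨rfl, ⟨rfl, rfl⟩ | ⟨rfl, rfl⟩⟩ | ⟨rfl, ⟨rfl, rfl⟩ | ⟨rfl, rfl⟩⟩
  · rfl
  · exact h3 hp hb h1
  · rw [h.hA]
  · rw [h.hA z x] at h1 ⊢; exact h3 hp hb h1
  · rw [h.hA x y] at hb ⊢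
    exact h3 (by unfold Pm at *; rw [← hp]; abel) hb h1
  · rw [h.hA x y] at hb ⊢; rw [h.hA z y] at h1 ⊢
    exact h3 (by unfold Pm at *; rw [← hp]; abel) hb h1

lemma Cl.perm (h : Abs A T Lv M) {q k : V} {D : Finset V} (hc : Cl A Lv M q k D) {x y z : V} (hp : Pm M x y z q k) :
    2 ≤ (A x y).card ∨ 2 ≤ (A x z).card ∨ 2 ≤ (A y z).card := by
  obtain ⟨hl, a, b, c, hp', h1, h2⟩ := hc
  have e : ({a} + {b} + {c} : Multiset V) = {x} + {y} + {z} := by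
    unfold Pm at hp hp'
    exact add_right_cancel (b := ({q} + {k} : Multiset V)) (by have := hp'.trans hp.symm; rw [← add_assoc, ← add_assoc]; exact this)
  rcases three_eq e with ⟨rfl, ⟨rfl, rfl⟩ | ⟨rfl, rfl⟩⟩ | ⟨rfl, ⟨rfl, rfl⟩ | ⟨rfl, rfl⟩⟩ | ⟨rfl, ⟨rfl, rfl⟩ | ⟨rfl, rfl⟩⟩ <;>
    first | tauto | (rw [h.hA] at h1; tauto)

lemma Abs.link1 (h : Abs A T Lv M) {x y s t u : V} (hp : Pm M x y s t u) {D D' : Finset V}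
    (hc : Cl A Lv M s t D) (hc' : Cl A Lv M s u D') (h1 : 2 ≤ (A x u).card) (h2 : 2 ≤ (A x t).card) : D = D' := by
  have e1 := hc.all h (x := x) (y := u) (z := y) (by unfold Pm at *; rw [← hp]; abel) h1
  have e2 := hc'.all h (x := x) (y := t) (z := y) (by unfold Pm at *; rw [← hp]; abel) h2
  rcases h.nin x t y s u (by unfold Pm at *; rw [← hp]; abel) with h3 | h3
  · have f1 := h.path u x y s t (by unfold Pm at *; rw [← hp]; abel) (by rwa [h.hA]) h3 hc.1
    have f2 := h.path t x y s u (by unfold Pm at *; rw [← hp]; abel) (by rwa [h.hA]) h3 hc'.1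
    rw [← e1, ← e2, h.hA x u, h.hA x t, ← f1, f2]
  · have f1 := h.path x u y t s (by unfold Pm at *; rw [← hp]; abel) h1 (by rw [h.t1 u y t, h.t2 y u t, h.t1 y t u]; exact h3) (h.l1 _ _ hc.1)
    have f2 := h.path x t y u s (by unfold Pm at *; rw [← hp]; abel) h2 h3 (h.l1 _ _ hc'.1)
    rw [← e1, ← e2, ← f1, ← f2]
    rw [h.t1 u y t, h.t2 y u t, h.t1]

lemma Abs.link2 (h : Abs A T Lv M) {x y s t u : V} (hp : Pm M x y s t u) {D D' : Finset V}
    (hc : Cl A Lv M s t D) (hc' : Cl A Lv M s u D') : D = D' := by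
  by_cases h0 : 2 ≤ (A x y).card
  · rw [← hc.all h (x := x) (y := y) (z := u) (by unfold Pm at *; rw [← hp]; abel) h0,
      hc'.all h (x := x) (y := y) (z := t) (by unfold Pm at *; rw [← hp]; abel) h0]
  have r1 := hc.perm h (x := x) (y := y) (z := u) (by unfold Pm at *; rw [← hp]; abel)
  have r2 := hc'.perm h (x := x) (y := y) (z := t) (by unfold Pm at *; rw [← hp]; abel)
  have r3 := h.na x u y t s (by unfold Pm at *; rw [← hp]; abel)
  have r4 := h.na y u x t s (by unfold Pm at *; rw [← hp]; abel)
  have : (2 ≤ (A x u).card ∧ 2 ≤ (A x t).card) ∨ (2 ≤ (A y u).card ∧ 2 ≤ (A y t).card) := by tauto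
  rcases this with ⟨a, b⟩ | ⟨a, b⟩
  · exact h.link1 hp hc hc' a b
  · exact h.link1 (x := y) (y := x) (by unfold Pm at *; rw [← hp]; abel) hc hc' a b

/-- reachability for disjoint cross pairs -/
lemma Abs.cross (h : Abs A T Lv M) {x s t u v : V} (hp : Pm M x s t u v) :
    (∃ D, Cl A Lv M s u D) ∨ (∃ D, Cl A Lv M t v D) ∨ (∃ D, Cl A Lv M s v D) ∨ (∃ D, Cl A Lv M t u D) := by
  have key : ∀ q k x y z, Pm M x y z q k → Lv q k → (¬ ∃ D, Cl A Lv M q k D) →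
      ¬ 2 ≤ (A x y).card ∧ ¬ 2 ≤ (A x z).card ∧ ¬ 2 ≤ (A y z).card := by
    intro q k x y z hp hl hn
    refine ⟨fun hb => hn ⟨_, hl, x, y, z, hp, hb, rfl⟩, fun hb => hn ⟨_, hl, x, z, y, by unfold Pm at *; rw [← hp]; abel, hb, rfl⟩,
      fun hb => hn ⟨_, hl, y, z, x, by unfold Pm at *; rw [← hp]; abel, hb, rfl⟩⟩
  by_contra hc
  simp only [not_or] at hc
  obtain ⟨c1, c2, c3, c4⟩ := hc
  have n1 := h.nv s u t v x (by unfold Pm at *; rw [← hp]; abel)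
  have n2 := h.nv s v t u x (by unfold Pm at *; rw [← hp]; abel)
  have a1 := h.na x t u v s (by unfold Pm at *; rw [← hp]; abel)
  have a2 := h.na x v t u s (by unfold Pm at *; rw [← hp]; abel)
  have a3 := h.na x u t v s (by unfold Pm at *; rw [← hp]; abel)
  have a4 := h.na x v s u t (by unfold Pm at *; rw [← hp]; abel)
  have a5 := h.na x s u v t (by unfold Pm at *; rw [← hp]; abel)
  have a7 := h.na x t s v u (by unfold Pm at *; rw [← hp]; abel)
  have a8 := h.na x s t u v hp
  have a6 := h.na x u s v t (by unfold Pm at *; rw [← hp]; abel)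
  rcases n1 with n1 | n1 <;> rcases n2 with n2 | n2
  · have k1 := key s u x t v (by unfold Pm at *; rw [← hp]; abel) n1 c1
    have k2 := key s v x t u (by unfold Pm at *; rw [← hp]; abel) n2 c3
    clear c1 c2 c3 c4 n1 n2 key
    omega
  · have k1 := key s u x t v (by unfold Pm at *; rw [← hp]; abel) n1 c1
    have k2 := key t u x s v (by unfold Pm at *; rw [← hp]; abel) n2 c4
    clear c1 c2 c3 c4 n1 n2 key
    omega
  · have k1 := key t v x s u (by unfold Pm at *; rw [← hp]; abel) n1 c2
    have k2 := key s v x t u (by unfold Pm at *; rw [← hp]; abel) n2 c3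
    clear c1 c2 c3 c4 n1 n2 key
    omega
  · have k1 := key t v x s u (by unfold Pm at *; rw [← hp]; abel) n1 c2
    have k2 := key t u x s v (by unfold Pm at *; rw [← hp]; abel) n2 c4
    clear c1 c2 c3 c4 n1 n2 key
    omega

lemma Abs.link3 (h : Abs A T Lv M) {x s t u v : V} (hp : Pm M x s t u v) {D D' : Finset V}
    (hc : Cl A Lv M s t D) (hc' : Cl A Lv M u v D') : D = D' := by
  rcases h.cross hp with ⟨E, e⟩ | ⟨E, e⟩ | ⟨E, e⟩ | ⟨E, e⟩
  · exact (h.link2 (x := x) (y := v) (s := s) (t := t) (u := u) (by unfold Pm at *; rw [← hp]; abel) hc e).trans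
      (h.link2 (x := x) (y := t) (s := u) (t := s) (u := v) (by unfold Pm at *; rw [← hp]; abel) (e.symm h) hc')
  · exact (h.link2 (x := x) (y := u) (s := t) (t := s) (u := v) (by unfold Pm at *; rw [← hp]; abel) (hc.symm h) e).trans
      (h.link2 (x := x) (y := s) (s := v) (t := t) (u := u) (by unfold Pm at *; rw [← hp]; abel) (e.symm h) (hc'.symm h))
  · exact (h.link2 (x := x) (y := u) (s := s) (t := t) (u := v) (by unfold Pm at *; rw [← hp]; abel) hc e).trans
      (h.link2 (x := x) (y := t) (s := v) (t := s) (u := u) (by unfold Pm at *; rw [← hp]; abel) (e.symm h) (hc'.symm h))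
  · exact (h.link2 (x := x) (y := v) (s := t) (t := s) (u := u) (by unfold Pm at *; rw [← hp]; abel) (hc.symm h) e).trans
      (h.link2 (x := x) (y := s) (s := u) (t := t) (u := v) (by unfold Pm at *; rw [← hp]; abel) (e.symm h) hc')
end Uniq


section Uniq2
variable {V : Type*} [DecidableEq V]
variable {A : V → V → Finset V} {T : V → V → V → Finset V} {Lv : V → V → Prop} {M : Multiset V}

lemma Pm.mem {x y z q k v : V} (hp : Pm M x y z q k) (hv : v ∈ M) : v = x ∨ v = y ∨ v = z ∨ v = q ∨ v = k := by
  unfold Pm at hp; rw [← hp] at hv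
  simp only [Multiset.mem_add, Multiset.mem_singleton] at hv; tauto

lemma Pm.mems {x y z q k : V} (hp : Pm M x y z q k) : x ∈ M ∧ y ∈ M ∧ z ∈ M ∧ q ∈ M ∧ k ∈ M := by
  unfold Pm at hp; rw [← hp]; simp

lemma Pm.ne {x y z q k : V} (hp : Pm M x y z q k) (hM : M.Nodup) : q ≠ k := by
  rintro rfl
  unfold Pm at hp; rw [← hp] at hM
  have : ({q} + {q} : Multiset V).Nodup := Multiset.nodup_of_le (by
    rw [add_assoc]; exact Multiset.le_add_left _ _) hM
  simp [Multiset.nodup_add] at this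

lemma Abs.u1 (h : Abs A T Lv M) {x y z q k k' : V} (hp : Pm M x y z q k) {D D' : Finset V}
    (hc : Cl A Lv M q k D) (hc' : Cl A Lv M q k' D') (hk : k' = x ∨ k' = y ∨ k' = z ∨ k' = k) : D = D' := by
  rcases hk with rfl | rfl | rfl | rfl
  · exact h.link2 (x := y) (y := z) (by unfold Pm at *; rw [← hp]; abel) hc hc'
  · exact h.link2 (x := x) (y := z) (by unfold Pm at *; rw [← hp]; abel) hc hc'
  · exact h.link2 (x := x) (y := y) (by unfold Pm at *; rw [← hp]; abel) hc hc'
  · obtain ⟨hl, a, b, c, hp', h1, rfl⟩ := hc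
    exact hc'.all h hp' h1

lemma Abs.u2 (h : Abs A T Lv M) {x y z q k k' : V} (hp : Pm M x y z q k) {D D' : Finset V}
    (hc : Cl A Lv M q k D) (hc' : Cl A Lv M x k' D') (hk : k' = y ∨ k' = z ∨ k' = q ∨ k' = k) : D = D' := by
  rcases hk with rfl | rfl | rfl | rfl
  · exact (h.link3 (x := z) (by unfold Pm at *; rw [← hp]; abel) hc hc')
  · exact (h.link3 (x := y) (by unfold Pm at *; rw [← hp]; abel) hc hc')
  · exact h.u1 hp hc (hc'.symm h) (Or.inl rfl)
  · exact h.u1 (x := x) (y := y) (z := z) (by unfold Pm at *; rw [← hp]; abel) (hc.symm h) (hc'.symm h) (Or.inl rfl)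

lemma Abs.uniq (h : Abs A T Lv M) (hM : M.Nodup) {q k q' k' : V} {D D' : Finset V}
    (hc : Cl A Lv M q k D) (hc' : Cl A Lv M q' k' D') : D = D' := by
  have hc0 := hc
  obtain ⟨hl, x, y, z, hp, h1, h2⟩ := hc0
  have hc0' := hc'
  obtain ⟨hl', x', y', z', hp', h1', h2'⟩ := hc0'
  have m1 := hp.mem hp'.mems.2.2.2.1
  have m2 := hp.mem hp'.mems.2.2.2.2
  have ne := hp'.ne hM
  rcases m1 with rfl | rfl | rfl | rfl | rfl
  · exact h.u2 hp hc hc' (by tauto)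
  · exact h.u2 (x := q') (y := x) (z := z) (by unfold Pm at *; rw [← hp]; abel) hc hc' (by tauto)
  · exact h.u2 (x := q') (y := x) (z := y) (by unfold Pm at *; rw [← hp]; abel) hc hc' (by tauto)
  · exact h.u1 hp hc hc' (by tauto)
  · exact h.u1 (x := x) (y := y) (z := z) (by unfold Pm at *; rw [← hp]; abel) (hc.symm h) hc' (by tauto)
end Uniq2

section UQ
variable {V : Type*} [DecidableEq V]
variable {col : Finset V → Bool} {W : Finset V} {a : V} {M : Multiset V}

/-- D is the colour pair of the window (a; M; G) -/
def WD (col : Finset V → Bool) (W : Finset V) (a : V) (M : Multiset V) (G : V → Prop) (D : Finset V) : Prop :=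
  D.card = 2 ∧ (∀ g, G g → ∀ x y z q k, Pm M x y z q k → 2 ≤ (RR col W a x y).card → RR col W q k g ⊆ D) ∧
  (∀ g, G g → ∀ x y z q k, Pm M x y z q k → 2 ≤ (RR col W a x y).card → (RR col W q k g).Nonempty → RR col W a x y = D) ∧
  (∃ (c : Cfg V) (o : V), c.vs + {o} = {a} + M ∧ c.X col W = D ∧ c.Y col W = D)

lemma reach' {g : V} (hN : NoSDR col W a M g) (hS : NS col W a M) {x y z q k : V}
    (hp : {x} + {y} + {z} + {q} + {k} = M)
    (h1 : 2 ≤ (RR col W a x y).card) (h3 : (RR col W q k g).Nonempty) :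
    (RR col W a x y).card = 2 ∧ RR col W q k g ⊆ RR col W a x y ∧ 
    ∃ (c : Cfg V) (o : V), c.vs + {o} = {a} + M ∧ c.X col W = RR col W a x y ∧ c.Y col W = RR col W a x y := by
  rcases ns_in hS hp with h | h
  · obtain ⟨e1, e2, e3⟩ := path_eq hN (i := y) (p := x) (j := z) (q := q) (k := k) (by rw [← hp]; abel) (by rwa [RR_sw2]) h h3
    rw [RR_sw2 a y x] at e1 e2 e3
    exact ⟨e1, e3, ⟨a, y, x, z, q⟩, k, by rw [← hp]; simp only [Cfg.vs]; abel, by show RR col W a y x = _; rw [RR_sw2], e2⟩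
  · obtain ⟨e1, e2, e3⟩ := path_eq hN (i := x) (p := y) (j := z) (q := k) (k := q) (by rw [← hp]; abel) h1 h (by rwa [RR_swap])
    rw [RR_swap] at e3
    exact ⟨e1, e3, ⟨a, x, y, z, k⟩, q, by rw [← hp]; simp only [Cfg.vs]; abel, rfl, e2⟩

lemma UQ (G : V → Prop) (hN : ∀ g, G g → NoSDR col W a M g) (hS : NS col W a M) (hM : M.Nodup) (h5 : ∃ x y z q k, Pm M x y z q k)
    (g0 : V) (hg0 : G g0)
    (nv : ∀ w x y z o, Pm M w x y z o → (RR col W w x g0).Nonempty ∨ (RR col W y z g0).Nonempty) :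
    ∃ D, WD col W a M G D := by
  have hab : Abs (fun x y => RR col W a x y) (fun x y z => RR col W x y z)
      (fun q k => ∃ g, G g ∧ (RR col W q k g).Nonempty) M := by
    refine ⟨fun x y => RR_sw2 _ _ _, fun x y z => RR_swap _ _ _ _ _, fun x y z => RR_sw2 _ _ _, ?_, ?_, ?_, ?_, ?_, ?_⟩
    · rintro x y ⟨g, h1, h2⟩; exact ⟨g, h1, by rwa [RR_swap]⟩
    · rintro i p j q k hp h1 h2 ⟨g, h3, h4⟩
      exact (path_eq (hN g h3) hp h1 h2 h4).2.1
    · intro x y z q k hp; exact ns_in hS hp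
    · intro x y z q k hp; exact ns_a hS hp
    · intro x y z q k hp; exact ns_p hS hp
    · intro w x y z o hp
      exact (nv w x y z o hp).imp (fun h => ⟨g0, hg0, h⟩) (fun h => ⟨g0, hg0, h⟩)
  have ex : ∃ x y z q k, Pm M x y z q k ∧ 2 ≤ (RR col W a x y).card ∧ (RR col W q k g0).Nonempty := by
    by_contra hc
    push Not at hc
    obtain ⟨o, w, x, y, z, hp⟩ := h5
    rcases reach2 hS hp (fun q k => RR col W q k g0 = ∅) (fun x y h => by rwa [RR_swap]) (fun x y z q k hp h => by
      simpa using hc x y z q k hp h) with ⟨h1, h2⟩ | ⟨h1, h2⟩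
    · have := nv w x y z o (by unfold Pm at *; rw [← hp]; abel)
      simp [h1, h2] at this
    · have := nv w y x z o (by unfold Pm at *; rw [← hp]; abel)
      simp [h1, h2] at this
  obtain ⟨x, y, z, q, k, hp, h1, h2⟩ := ex
  obtain ⟨r1, r2, r3⟩ := reach' (hN g0 hg0) hS hp h1 h2
  have cl0 : Cl (fun x y => RR col W a x y) (fun q k => ∃ g, G g ∧ (RR col W q k g).Nonempty) M q k (RR col W a x y) :=
    ⟨⟨g0, hg0, h2⟩, x, y, z, hp, h1, rfl⟩
  have all : ∀ g, G g → ∀ x' y' z' q' k', Pm M x' y' z' q' k' → 2 ≤ (RR col W a x' y').card → (RR col W q' k' g).Nonempty →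
      RR col W a x' y' = RR col W a x y := by
    intro g hg x' y' z' q' k' hp' h1' h2'
    exact hab.uniq hM (q := q') (k := k') (q' := q) (k' := k) ⟨⟨g, hg, h2'⟩, x', y', z', hp', h1', rfl⟩ cl0
  refine ⟨RR col W a x y, r1, ?_, all, r3⟩
  intro g hg x' y' z' q' k' hp' h1'
  rcases Finset.eq_empty_or_nonempty (RR col W q' k' g) with h | h
  · rw [h]; simp
  · rw [← all g hg x' y' z' q' k' hp' h1' h]
    exact (reach' (hN g hg) hS hp' h1' h).2.1

/-- two of three pairs reachable -/
lemma two_reach {x2 x3 x4 x5 x6 : V} {G : V → Prop} {D : Finset V} (hS : NS col W a M) (hD : WD col W a M G D)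
    (hp : Pm M x2 x3 x4 x5 x6) :
    ((∀ g, G g → RR col W x4 x5 g ⊆ D) ∧ (∀ g, G g → RR col W x4 x6 g ⊆ D)) ∨
    ((∀ g, G g → RR col W x4 x5 g ⊆ D) ∧ (∀ g, G g → RR col W x5 x6 g ⊆ D)) ∨
    ((∀ g, G g → RR col W x4 x6 g ⊆ D) ∧ (∀ g, G g → RR col W x5 x6 g ⊆ D)) := by
  have key : ∀ x y z q k, Pm M x y z q k → ¬ (∀ g, G g → RR col W q k g ⊆ D) →
      ¬ 2 ≤ (RR col W a x y).card ∧ ¬ 2 ≤ (RR col W a x z).card ∧ ¬ 2 ≤ (RR col W a y z).card := by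
    intro x y z q k hp hn
    refine ⟨fun h => hn fun g hg => hD.2.1 g hg x y z q k hp h, fun h => hn fun g hg => hD.2.1 g hg x z y q k (by unfold Pm at *; rw [← hp]; abel) h,
      fun h => hn fun g hg => hD.2.1 g hg y z x q k (by unfold Pm at *; rw [← hp]; abel) h⟩
  by_contra hc
  have k1 := key x2 x3 x6 x4 x5 (by unfold Pm at *; rw [← hp]; abel)
  have k2 := key x2 x3 x5 x4 x6 (by unfold Pm at *; rw [← hp]; abel)
  have k3 := key x2 x3 x4 x5 x6 hp
  have a1 := ns_a hS (w := x2) (x := x6) (y := x3) (z := x5) (o := x4) (by unfold Pm at *; rw [← hp]; abel)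
  have a2 := ns_a hS (w := x2) (x := x6) (y := x3) (z := x4) (o := x5) (by unfold Pm at *; rw [← hp]; abel)
  have a3 := ns_a hS (w := x2) (x := x5) (y := x3) (z := x4) (o := x6) (by unfold Pm at *; rw [← hp]; abel)
  by_cases b1 : (∀ g, G g → RR col W x4 x5 g ⊆ D)
  · have b2 : ¬ (∀ g, G g → RR col W x4 x6 g ⊆ D) := fun h => hc (Or.inl ⟨b1, h⟩)
    have b3 : ¬ (∀ g, G g → RR col W x5 x6 g ⊆ D) := fun h => hc (Or.inr (Or.inl ⟨b1, h⟩))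
    have k2 := k2 b2
    have k3 := k3 b3
    clear key b1 b2 b3 hc k1
    omega
  have k1 := k1 b1
  by_cases b2 : (∀ g, G g → RR col W x4 x6 g ⊆ D)
  · have b3 : ¬ (∀ g, G g → RR col W x5 x6 g ⊆ D) := fun h => hc (Or.inr (Or.inr ⟨b2, h⟩))
    have k3 := k3 b3
    clear key b1 b2 b3 hc k2
    omega
  · have k2 := k2 b2
    clear key b1 b2 hc k3
    omega

/-- D-good configuration for the next window -/
lemma next_good {x2 x3 x4 x5 x6 x7 x8 x9 : V} {G : V → Prop} {D : Finset V} (hS : NS col W a M) (hD : WD col W a M G D)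
    (hp : Pm M x2 x3 x4 x5 x6) (h7 : G x7) (h8 : G x8) :
    ∃ (c : Cfg V) (o : V), c.vs + {o} = {x4} + ({x5} + {x6} + {x7} + {x8} + {x9}) ∧ c.X col W ⊆ D ∧ c.Y col W ⊆ D := by
  rcases two_reach hS hD hp with ⟨h1, h2⟩ | ⟨h1, h2⟩ | ⟨h1, h2⟩
  · refine ⟨⟨x5, x7, x4, x6, x8⟩, x9, by simp only [Cfg.vs]; abel, ?_, ?_⟩
    · show RR col W x5 x7 x4 ⊆ D; rw [← RR_rot]; exact h1 _ h7
    · exact h2 _ h8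
  · refine ⟨⟨x4, x7, x5, x6, x8⟩, x9, by simp only [Cfg.vs]; abel, ?_, ?_⟩
    · show RR col W x4 x7 x5 ⊆ D; rw [RR_sw2]; exact h1 _ h7
    · exact h2 _ h8
  · refine ⟨⟨x4, x7, x6, x5, x8⟩, x9, by simp only [Cfg.vs]; abel, ?_, ?_⟩
    · show RR col W x4 x7 x6 ⊆ D; rw [RR_sw2]; exact h1 _ h7
    · show RR col W x6 x5 x8 ⊆ D; rw [RR_swap]; exact h2 _ h8

lemma ov1 {g : V} {G : V → Prop} {D D1 : Finset V} (hD : WD col W a M G D) (hg : G g) (h1 : D1.card = 2)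
    (nv : ∀ w x y z o, Pm M w x y z o → (RR col W w x g).Nonempty ∨ (RR col W y z g).Nonempty)
    {b b' s s' s'' : V} (hp : Pm M b b' s s' s'') (e1 : RR col W a b s = D1) (e2 : RR col W a b s' = D1) : D1 = D := by
  rcases nv b' s' s s'' b (by unfold Pm at *; rw [← hp]; abel) with h | h
  · rw [← e1]; exact hD.2.2.1 g hg b s s'' b' s' (by unfold Pm at *; rw [← hp]; abel) (by rw [e1, h1]) h
  · rw [← e2]; exact hD.2.2.1 g hg b s' b' s s'' (by unfold Pm at *; rw [← hp]; abel) (by rw [e2, h1]) h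

lemma ov2 {g : V} {G : V → Prop} {D D1 : Finset V} (hN : NoSDR col W a M g) (hS : NS col W a M) (hD : WD col W a M G D) (hg : G g) (h1 : D1.card = 2)
    (nv : ∀ w x y z o, Pm M w x y z o → (RR col W w x g).Nonempty ∨ (RR col W y z g).Nonempty)
    {b c s s' s'' : V} (hp : Pm M b c s s' s'')
    (r : ∀ h, h = s ∨ h = s' ∨ h = s'' → RR col W c b h ⊆ D1)
    (n1 : ¬ 2 ≤ (RR col W a c s).card) (n2 : ¬ 2 ≤ (RR col W a c s').card) : D1 = D := by
  have tb : ∀ h, h = s ∨ h = s' ∨ h = s'' → 2 ≤ (RR col W c b h).card ∧ 2 ≤ (RR col W a b h).card := by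
    have f1 := ns_p hS (i := s) (p := c) (j := b) (q := s') (k := s'') (by unfold Pm at *; rw [← hp]; abel)
    have f2 := ns_p hS (i := s) (p := c) (j := b) (q := s'') (k := s') (by unfold Pm at *; rw [← hp]; abel)
    have f3 := ns_p hS (i := s') (p := c) (j := b) (q := s) (k := s'') (by unfold Pm at *; rw [← hp]; abel)
    have g1 := ns_a hS (w := c) (x := s) (y := b) (z := s') (o := s'') (by unfold Pm at *; rw [← hp]; abel)
    have g2 := ns_a hS (w := c) (x := s) (y := b) (z := s'') (o := s') (by unfold Pm at *; rw [← hp]; abel)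
    have g3 := ns_a hS (w := c) (x := s') (y := b) (z := s) (o := s'') (by unfold Pm at *; rw [← hp]; abel)
    rw [RR_sw2 a s c] at f1 f2; rw [RR_sw2 a s' c] at f3
    rintro h (rfl | rfl | rfl)
    · exact ⟨f3.resolve_left n2, g3.resolve_left n2⟩
    · exact ⟨f1.resolve_left n1, g1.resolve_left n1⟩
    · exact ⟨f2.resolve_left n1, g2.resolve_left n1⟩
  have eq : ∀ h, h = s ∨ h = s' ∨ h = s'' → RR col W c b h = D1 := fun h hh =>
    Finset.eq_of_subset_of_card_le (r h hh) (by rw [h1]; exact (tb h hh).1)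
  rcases nv c s s' s'' b (by unfold Pm at *; rw [← hp]; abel) with h | h
  · have e := (path_eq hN (i := s') (p := b) (j := s'') (q := c) (k := s) (by unfold Pm at *; rw [← hp]; abel)
      (by rw [RR_sw2]; exact (tb s' (by tauto)).2) (by rw [← RR_rot]; exact (tb s'' (by tauto)).1) h).2.1
    rw [← RR_rot, eq s'' (by tauto), RR_sw2] at e
    rw [e]
    exact hD.2.2.1 g hg b s' s'' c s (by unfold Pm at *; rw [← hp]; abel) (tb s' (by tauto)).2 h
  · have e := (path_eq hN (i := s) (p := b) (j := c) (q := s') (k := s'') (by unfold Pm at *; rw [← hp]; abel)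
      (by rw [RR_sw2]; exact (tb s (by tauto)).2) (by rw [RR_swap]; exact (tb s' (by tauto)).1) h).2.1
    rw [RR_swap, eq s' (by tauto), RR_sw2] at e
    rw [e]
    exact hD.2.2.1 g hg b s c s' s'' (by unfold Pm at *; rw [← hp]; abel) (tb s (by tauto)).2 h

lemma ov3 {g : V} {G : V → Prop} {D D1 : Finset V} (hN : NoSDR col W a M g) (hS : NS col W a M) (hD : WD col W a M G D) (hg : G g) (h1 : D1.card = 2)
    (nv : ∀ w x y z o, Pm M w x y z o → (RR col W w x g).Nonempty ∨ (RR col W y z g).Nonempty)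
    {b c s s' s'' : V} (hp : Pm M b c s s' s'')
    (r : ∀ h, h = s ∨ h = s' ∨ h = s'' → RR col W a c h ⊆ D1)
    (r' : ∀ s s' s'', Pm M b c s s' s'' → ¬ 2 ≤ (RR col W a c s).card → ¬ 2 ≤ (RR col W a c s').card → D1 = D) : D1 = D := by
  have eq : ∀ h, h = s ∨ h = s' ∨ h = s'' → 2 ≤ (RR col W a c h).card → RR col W a c h = D1 := fun h hh hb =>
    Finset.eq_of_subset_of_card_le (r h hh) (by rw [h1]; exact hb)
  by_cases b1 : 2 ≤ (RR col W a c s).card <;> by_cases b2 : 2 ≤ (RR col W a c s').card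
  · exact ov1 hD hg h1 nv (b := c) (b' := b) (s := s) (s' := s') (s'' := s'') (by unfold Pm at *; rw [← hp]; abel) (eq _ (by tauto) b1) (eq _ (by tauto) b2)
  all_goals by_cases b3 : 2 ≤ (RR col W a c s'').card
  · exact ov1 hD hg h1 nv (b := c) (b' := b) (s := s) (s' := s'') (s'' := s') (by unfold Pm at *; rw [← hp]; abel) (eq _ (by tauto) b1) (eq _ (by tauto) b3)
  · exact r' s' s'' s (by unfold Pm at *; rw [← hp]; abel) b2 b3
  · exact ov1 hD hg h1 nv (b := c) (b' := b) (s := s') (s' := s'') (s'' := s) (by unfold Pm at *; rw [← hp]; abel) (eq _ (by tauto) b2) (eq _ (by tauto) b3)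
  · exact r' s s'' s' (by unfold Pm at *; rw [← hp]; abel) b1 b3
  · exact r' s s' s'' hp b1 b2
  · exact r' s s' s'' hp b1 b2

/-- consecutive windows have the same D -/
lemma ovl {a1 : V} {M1 : Multiset V} {G1 : V → Prop} {D1 : Finset V} {x2 x3 x4 x5 x6 x7 x8 x9 : V}
    (hS1 : NS col W a1 M1) (hD1 : WD col W a1 M1 G1 D1) (hp1 : Pm M1 x2 x3 x4 x5 x6) (h7 : G1 x7) (h8 : G1 x8) (h9 : G1 x9)
    {g : V} {G : V → Prop} {D : Finset V} (hN : NoSDR col W x4 M g) (hS : NS col W x4 M) (hD : WD col W x4 M G D) (hg : G g)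
    (nv : ∀ w x y z o, Pm M w x y z o → (RR col W w x g).Nonempty ∨ (RR col W y z g).Nonempty)
    (hp : Pm M x5 x6 x7 x8 x9) : D1 = D := by
  have mem : ∀ {b c s s' s''}, Pm M b c s s' s'' → ({b} + {c} : Multiset V) = {x5} + {x6} → ∀ h, h = s ∨ h = s' ∨ h = s'' → G1 h := by
    intro b c s s' s'' hp' hbc
    have e : ({s} + {s'} + {s''} : Multiset V) = {x7} + {x8} + {x9} := by
      unfold Pm at hp hp'
      apply add_left_cancel (a := ({b} + {c} : Multiset V))
      calc _ = M := by rw [← hp']; abel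
        _ = _ := by rw [hbc, ← hp]; abel
    intro h hh
    rcases three_eq e with ⟨rfl, ⟨rfl, rfl⟩ | ⟨rfl, rfl⟩⟩ | ⟨rfl, ⟨rfl, rfl⟩ | ⟨rfl, rfl⟩⟩ | ⟨rfl, ⟨rfl, rfl⟩ | ⟨rfl, rfl⟩⟩ <;>
      rcases hh with rfl | rfl | rfl <;> assumption
  have hp' : Pm M x6 x5 x7 x8 x9 := by unfold Pm at *; rw [← hp]; abel
  rcases two_reach hS1 hD1 hp1 with ⟨h1, h2⟩ | ⟨h1, h2⟩ | ⟨h1, h2⟩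
  · refine ov3 hN hS hD hg hD1.1 nv hp' (fun h hh => h1 h (mem hp' (add_comm _ _) h hh)) ?_
    intro s s' s'' hq n1 n2
    -- x5 small at s, s' hence x6 big everywhere
    have hq' : Pm M x5 x6 s s' s'' := by unfold Pm at *; rw [← hq]; abel
    have g1 := (ns_a hS (w := x5) (x := s) (y := x6) (z := s') (o := s'') (by unfold Pm at *; rw [← hq]; abel)).resolve_left n1
    have g2 := (ns_a hS (w := x5) (x := s) (y := x6) (z := s'') (o := s') (by unfold Pm at *; rw [← hq]; abel)).resolve_left n1
    have eq : ∀ h, h = s ∨ h = s' ∨ h = s'' → 2 ≤ (RR col W x4 x6 h).card → RR col W x4 x6 h = D1 := fun h hh hb =>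
      Finset.eq_of_subset_of_card_le (h2 h (mem hq (add_comm _ _) h hh)) (by rw [hD1.1]; exact hb)
    exact ov1 hD hg hD1.1 nv (b := x6) (b' := x5) (s := s') (s' := s'') (s'' := s) (by unfold Pm at *; rw [← hq]; abel) (eq _ (by tauto) g1) (eq _ (by tauto) g2)
  · refine ov3 hN hS hD hg hD1.1 nv hp' (fun h hh => h1 h (mem hp' (add_comm _ _) h hh)) ?_
    intro s s' s'' hq n1 n2
    exact ov2 hN hS hD hg hD1.1 nv hq (fun h hh => h2 h (mem hq (add_comm _ _) h hh)) n1 n2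
  · refine ov3 hN hS hD hg hD1.1 nv hp (fun h hh => h1 h (mem hp rfl h hh)) ?_
    intro s s' s'' hq n1 n2
    exact ov2 hN hS hD hg hD1.1 nv hq (fun h hh => by rw [RR_swap]; exact h2 h (mem hq rfl h hh)) n1 n2
end UQ


section Cy
variable {V : Type*} [DecidableEq V]
variable {col : Finset V → Bool} {W : Finset V}

def Cyc (col : Finset V → Bool) (W : Finset V) (l : ℕ) (u : V) (L : List (V × V × V)) : Prop :=
  Pth col true u L u ∧ L.length = l ∧ Fr W (fl L)

variable {l : ℕ}

lemma Cyc.rot {u x y z : V} {L : List (V × V × V)} (h : Cyc col W l u ((x, y, z) :: L)) :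
    Cyc col W l z (L ++ [(x, y, z)]) := by
  obtain ⟨h1, h2, h3⟩ := h
  refine ⟨?_, by simpa using h2, ?_⟩
  · exact (Pth_append _ _ _ _).2 ⟨u, h1.2, h1.1, rfl⟩
  · convert h3 using 1; rw [fl_append]; simp only [fl]; abel

lemma Cyc.rots {u : V} (L R : List (V × V × V)) (h : Cyc col W l u (L ++ R)) :
    ∃ w, Cyc col W l w (R ++ L) ∧ Pth col true u L w := by
  obtain ⟨h1, h2, h3⟩ := h
  obtain ⟨w, a, b⟩ := (Pth_append _ _ _ _).1 h1
  refine ⟨w, ⟨(Pth_append _ _ _ _).2 ⟨u, b, a⟩, by simp at h2 ⊢; omega, ?_⟩, a⟩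
  rw [fl_append, add_comm, ← fl_append]; exact h3

def rv : V → List (V × V × V) → List (V × V × V)
  | _, [] => []
  | u, (x, y, z) :: L => rv z L ++ [(y, x, u)]

lemma rv_len (u : V) (L : List (V × V × V)) : (rv u L).length = L.length := by
  induction L generalizing u with
  | nil => rfl
  | cons t L ih => obtain ⟨x, y, z⟩ := t; simp [rv, ih]

lemma rv_pth {b : Bool} {u v : V} {L : List (V × V × V)} (h : Pth col b u L v) : Pth col b v (rv u L) u := by
  induction L generalizing u with
  | nil => exact Eq.symm h
  | cons t L ih =>
    obtain ⟨x, y, z⟩ := t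
    refine (Pth_append _ _ _ _).2 ⟨z, ih h.2, ?_, rfl⟩
    rw [← h.1]; congr 1; ext; simp only [Finset.mem_insert, Finset.mem_singleton]; tauto

lemma rv_fl {b : Bool} {u v : V} {L : List (V × V × V)} (h : Pth col b u L v) : fl (rv u L) + {v} = {u} + fl L := by
  induction L generalizing u with
  | nil => simp only [Pth] at h; subst h; simp [rv, fl]
  | cons t L ih =>
    obtain ⟨x, y, z⟩ := t
    have := ih h.2
    simp only [rv, fl_append, fl]
    calc _ = (fl (rv z L) + {v}) + ({y} + {x} + {u}) := by abel
      _ = _ := by rw [this]; abel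

lemma Cyc.rev {u x2 x3 x4 x5 x6 x7 : V} {R : List (V × V × V)}
    (h : Cyc col W l u ((x2, x3, x4) :: (x5, x6, x7) :: R)) :
    ∃ R', R'.length = R.length ∧ Cyc col W l x7 ((x6, x5, x4) :: (x3, x2, u) :: R') := by
  obtain ⟨⟨h1, h2, h3⟩, h4, h5⟩ := h
  refine ⟨rv x7 R, rv_len _ _, ⟨?_, ?_, rv_pth h3⟩, by simpa [rv_len] using h4, ?_⟩
  · rw [← h2]; congr 1; ext; simp only [Finset.mem_insert, Finset.mem_singleton]; tauto
  · rw [← h1]; congr 1; ext; simp only [Finset.mem_insert, Finset.mem_singleton]; tauto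
  · convert h5 using 1
    have := rv_fl h3
    simp only [fl]
    calc _ = {x6} + {x5} + {x4} + {x3} + {x2} + ((fl (rv x7 R) + {u}) : Multiset V) := by abel
      _ = {x6} + {x5} + {x4} + {x3} + {x2} + ({x7} + fl R) := by rw [this]
      _ = _ := by abel

lemma stl_app {b : Bool} {u w : V} {L : List (V × V × V)} (R : List (V × V × V)) (h : Pth col b u L w) :
    stl u (L ++ R) = stl u L ++ stl w R := by
  induction L generalizing u with
  | nil => simp only [Pth] at h; subst h; simp [stl]
  | cons t L ih => obtain ⟨x, y, z⟩ := t; simp [stl, ih h.2]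

lemma Cyc.stl {u : V} {L : List (V × V × V)} (h : Cyc col W l u L) : (stl u L : Multiset V) = fl L := by
  have := stl_fl u u L h.1
  apply add_right_cancel (b := ({u} : Multiset V)); rw [this, add_comm]

lemma Cyc.noSDR {u x2 x3 x4 x5 x6 x7 x8 x9 x10 : V} {R : List (V × V × V)} (hno : ¬ HC col true (l + 1))
    (h : Cyc col W l u ((x2, x3, x4) :: (x5, x6, x7) :: (x8, x9, x10) :: R)) (g : V) (hg : g = x7 ∨ g = x8 ∨ g = x9) :
    NoSDR col W u ({x2} + {x3} + {x4} + {x5} + {x6}) g := by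
  obtain ⟨⟨h1, h2, h3, h4⟩, h5, h6⟩ := h
  simp only [fl] at h6
  have key : ∀ s t, Fr W ({x2} + {x3} + {x4} + {x5} + {x6} + {g} + ({s} + {t} + {x10} + fl R)) → col {g, s, t, x10} = true →
      NoSDR col W u ({x2} + {x3} + {x4} + {x5} + {x6}) g := by
    intro s t hf hc
    refine noSDR_of (Q := (s, t, x10) :: R) ⟨hc, h4⟩ rfl (fun h => hno ?_) hf.1 hf.2
    convert h using 1; simp at h5 ⊢; omega
  rcases hg with rfl | rfl | rfl
  · exact key x8 x9 (by convert h6 using 1; abel) h3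
  · refine key x7 x9 (by convert h6 using 1; abel) ?_
    rw [← h3]; congr 1; ext; simp only [Finset.mem_insert, Finset.mem_singleton]; tauto
  · refine key x8 x7 (by convert h6 using 1; abel) ?_
    rw [← h3]; congr 1; ext; simp only [Finset.mem_insert, Finset.mem_singleton]; tauto

lemma void_front (q : ℕ) {u x2 x3 x4 x5 x6 x7 : V} {R : List (V × V × V)} (hno : ¬ HC col true (l + 1))
    (h : Cyc col W l u ((x2, x3, x4) :: (x5, x6, x7) :: R)) (hR : 2 * (q + 1) ≤ R.length) (hW : q + 4 ≤ W.card)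
    (hV : Vd col W ({x2} + {x3} + {x4} + {x5} + {x6}) x7) : HC col false (2 * (q + 2)) := by
  obtain ⟨⟨h1, h2, h3⟩, h4, h5⟩ := h
  obtain ⟨c, hc, hX, hY⟩ := hV x6 x2 x3 x4 x5 (by abel)
  obtain ⟨L1, R2, w, rfl, e1, e2, e3⟩ := split_path h3 _ hR
  simp only [fl, fl_append] at h5
  obtain ⟨cs, a', F, L', c1, c2, c3, c4, c5, c6⟩ := chain q x7 w x6 L1 (R2 ++ [(x2, x3, x4), (x5, x6, x7)])
    (R2 ++ [(x2, x3, x4), (x5, x7, x6)]) e1 e2 ((Pth_append _ _ _ _).2 ⟨u, e3, h1, h2, rfl⟩)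
    ((Pth_append _ _ _ _).2 ⟨u, e3, h1, by
      rw [← h2]; congr 1; ext; simp only [Finset.mem_insert, Finset.mem_singleton]; tauto, rfl⟩)
    (by simp only [fl_append, fl]; abel) (by simp) (by convert h5 using 1; simp only [fl_append, fl]; abel)
    (by simp [fl_append, fl]) (by omega) (fun h => hno (by convert h using 1; simp at h4 ⊢; omega))
  cases cs with
  | nil => simp at c1
  | cons d ds =>
    have := ev_void c d ds ?_ hX hY (fun e he => (c2 e he).ty.le2) (by simp at c1; omega)
    · convert this using 3; simp at c1; omega
    · refine h5.of_add (C := {a'} + F + fl R2) ?_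
      rw [vss_cons]
      calc _ = c.vs + (vss (d :: ds) + {a'} + F) + fl R2 := by abel
        _ = (c.vs + {x6}) + fl L1 + fl R2 := by rw [c6]; abel
        _ = _ := by rw [hc]; abel

lemma sel (Inv : V → List (V × V × V) → Prop) (P : Cfg V → Prop)
    (rot : ∀ u x y z R, Inv u ((x, y, z) :: R) → Inv z (R ++ [(x, y, z)]))
    (conf : ∀ u x2 x3 x4 x5 x6 x7 R, Inv u ((x2, x3, x4) :: (x5, x6, x7) :: R) → ∃ (c : Cfg V) (o : V),
      c.vs + {o} = {u} + ({x2} + {x3} + {x4} + {x5} + {x6}) ∧ P c) (k : ℕ) :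
    ∀ (u : V) (L R : List (V × V × V)), L.length = 2 * k → Inv u (L ++ R) →
      ∃ (cs : List (Cfg V)) (F : Multiset V), cs.length = k ∧ (∀ c ∈ cs, P c) ∧ vss cs + F = (stl u L : Multiset V) := by
  induction k with
  | zero => intro u L R hL _; exact ⟨[], stl u L, rfl, by simp, by simp [vss]⟩
  | succ k ih =>
    intro u L R hL hi
    match L, hL with
    | (x2, x3, x4) :: (x5, x6, x7) :: L, hL =>
      obtain ⟨c, o, hc, hP⟩ := conf _ _ _ _ _ _ _ _ hi
      have hi' := rot _ _ _ _ _ (rot _ _ _ _ _ hi)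
      obtain ⟨cs, F, f1, f2, f3⟩ := ih x7 L (R ++ [(x2, x3, x4)] ++ [(x5, x6, x7)]) (by simp at hL; omega) (by
        convert hi' using 1; simp)
      refine ⟨c :: cs, F + {o}, by simp [f1], by simpa using ⟨hP, f2⟩, ?_⟩
      rw [vss_cons]
      calc _ = (c.vs + {o}) + (vss cs + F) := by abel
        _ = _ := by
          rw [hc, f3]; simp only [stl, ← Multiset.cons_coe, ← Multiset.singleton_add]; abel

lemma comb (Inv : V → List (V × V × V) → Prop) (P : Cfg V → Prop)
    (hI : ∀ u L, Inv u L → Cyc col W l u L)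
    (rot : ∀ u x y z R, Inv u ((x, y, z) :: R) → Inv z (R ++ [(x, y, z)]))
    (conf : ∀ u x2 x3 x4 x5 x6 x7 R, Inv u ((x2, x3, x4) :: (x5, x6, x7) :: R) → ∃ (c : Cfg V) (o : V),
      c.vs + {o} = {u} + ({x2} + {x3} + {x4} + {x5} + {x6}) ∧ P c) (k : ℕ)
    {u x2 x3 x4 x5 x6 x7 : V} {R : List (V × V × V)} (h : Inv u ((x2, x3, x4) :: (x5, x6, x7) :: R))
    (hk : 2 * k ≤ R.length) {c : Cfg V} {o : V} (hc : c.vs + {o} = {u} + ({x2} + {x3} + {x4} + {x5} + {x6})) :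
    ∃ cs : List (Cfg V), cs.length = k ∧ (∀ c ∈ cs, P c) ∧ Ok W (c :: cs) := by
  have hC := hI _ _ h
  have hst := hC.stl
  obtain ⟨⟨h1, h2, h3⟩, h4, h5⟩ := hC
  obtain ⟨L1, R2, w, rfl, e1, e2, e3⟩ := split_path h3 _ hk
  have hi' := rot _ _ _ _ _ (rot _ _ _ _ _ h)
  obtain ⟨cs, F, f1, f2, f3⟩ := sel Inv P rot conf k x7 L1 (R2 ++ [(x2, x3, x4)] ++ [(x5, x6, x7)]) e1 (by
        convert hi' using 1; simp)
  refine ⟨cs, f1, f2, ?_⟩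
  rw [← hst] at h5
  refine h5.of_add (C := {o} + F + (stl w R2 : Multiset V)) ?_
  rw [vss_cons]
  calc _ = (c.vs + {o}) + (vss cs + F) + (stl w R2 : Multiset V) := by abel
    _ = _ := by
      rw [hc, f3]; simp only [stl, stl_app R2 e2, ← Multiset.cons_coe, ← Multiset.singleton_add, ← Multiset.coe_add]; abel
end Cy


section EV
variable {V : Type*} [DecidableEq V]
variable {col : Finset V → Bool} {W : Finset V} {l : ℕ}

/-- everything known about windows when no long red / even blue cycle exists -/
structure Hyp (col : Finset V → Bool) (W : Finset V) (l q : ℕ) : Prop where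
  no : ¬ HC col true (l + 1)
  nb : ¬ HC col false (2 * (q + 2))
  hl : 2 * (q + 2) ≤ l
  hW : q + 4 ≤ W.card

variable {q : ℕ}

lemma Cyc.len {u : V} {L : List (V × V × V)} (h : Cyc col W l u L) : L.length = l := h.2.1

lemma Hyp.ty (H : Hyp col W l q) {u x2 x3 x4 x5 x6 x7 : V} {R : List (V × V × V)}
    (h : Cyc col W l u ((x2, x3, x4) :: (x5, x6, x7) :: R)) : ∃ (c : Cfg V) (o : V),
      c.vs + {o} = {u} + ({x2} + {x3} + {x4} + {x5} + {x6}) ∧ Ty col W c := by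
  have hlen := h.len
  have hl := H.hl
  simp only [List.length_cons] at hlen
  have hV : ¬ Vd col W ({x2} + {x3} + {x4} + {x5} + {x6}) x7 := fun hV =>
    H.nb (void_front q H.no h (by omega) H.hW hV)
  cases R with
  | nil => simp at hlen; omega
  | cons t R =>
    obtain ⟨x8, x9, x10⟩ := t
    rcases tri (h.noSDR H.no x7 (Or.inl rfl)) with ⟨c, o, h1, h2⟩ | ⟨i, p, j, q', k, hp, h1, h2, h3⟩ | h'
    · exact ⟨c, o, h1, Or.inl h2⟩
    · exact ⟨⟨u, i, p, j, q'⟩, k, by rw [← hp]; simp only [Cfg.vs]; abel, Or.inr ⟨h1, h2⟩⟩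
    · exact absurd h' hV

lemma Hyp.nvL (H : Hyp col W l q) {u x2 x3 x4 x5 x6 x7 : V} {R : List (V × V × V)}
    (h : Cyc col W l u ((x2, x3, x4) :: (x5, x6, x7) :: R)) (w x y z o : V)
    (hp : Pm ({x2} + {x3} + {x4} + {x5} + {x6}) w x y z o) : (RR col W w x u).Nonempty ∨ (RR col W y z u).Nonempty := by
  by_contra hc
  simp only [not_or, Finset.not_nonempty_iff_eq_empty] at hc
  have hlen := h.len
  have hl := H.hl
  simp only [List.length_cons] at hlen
  obtain ⟨cs, f1, f2, f3⟩ := comb (Cyc col W l) (Ty col W) (fun _ _ h => h) (fun _ _ _ _ _ h => h.rot)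
    (fun _ _ _ _ _ _ _ _ h => H.ty h) (q + 1) h (by omega) (c := ⟨w, x, u, y, z⟩) (o := o)
    (by unfold Pm at hp; rw [← hp]; simp only [Cfg.vs]; abel)
  cases cs with
  | nil => simp at f1
  | cons d ds =>
    simp at f1
    have := ev_void _ d ds f3 hc.1 (by show RR col W u y z = ∅; rw [RR_rot]; exact hc.2) (fun e he => (f2 e he).le2) (by have := H.hW; omega)
    rw [f1] at this
    exact H.nb this

lemma Hyp.nvR (H : Hyp col W l q) {u x2 x3 x4 x5 x6 x7 : V} {R : List (V × V × V)}
    (h : Cyc col W l u ((x2, x3, x4) :: (x5, x6, x7) :: R)) (w x y z o : V)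
    (hp : Pm ({x2} + {x3} + {x4} + {x5} + {x6}) w x y z o) : (RR col W w x x7).Nonempty ∨ (RR col W y z x7).Nonempty := by
  obtain ⟨R', _, hR⟩ := h.rev
  exact H.nvL hR w x y z o (by unfold Pm at *; rw [hp]; abel)

def Gp (x7 x8 x9 : V) (g : V) : Prop := g = x7 ∨ g = x8 ∨ g = x9

lemma Hyp.wd (H : Hyp col W l q) {u x2 x3 x4 x5 x6 x7 x8 x9 x10 : V} {R : List (V × V × V)}
    (h : Cyc col W l u ((x2, x3, x4) :: (x5, x6, x7) :: (x8, x9, x10) :: R))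
    (hS : NS col W u ({x2} + {x3} + {x4} + {x5} + {x6})) :
    ∃ D, WD col W u ({x2} + {x3} + {x4} + {x5} + {x6}) (Gp x7 x8 x9) D := by
  refine UQ (Gp x7 x8 x9) (fun g hg => h.noSDR H.no g hg) hS ?_ ⟨x2, x3, x4, x5, x6, rfl⟩ x7 (Or.inl rfl) (H.nvR h)
  have := h.2.2
  simp only [fl] at this
  exact (this.of_add (C := {x7} + ({x8} + {x9} + {x10} + fl R)) (by abel)).1

lemma Hyp.ov (H : Hyp col W l q) {u x2 x3 x4 x5 x6 x7 x8 x9 x10 x11 x12 x13 : V} {R : List (V × V × V)}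
    (h : Cyc col W l u ((x2, x3, x4) :: (x5, x6, x7) :: (x8, x9, x10) :: (x11, x12, x13) :: R))
    (hS : NS col W u ({x2} + {x3} + {x4} + {x5} + {x6})) (hS' : NS col W x4 ({x5} + {x6} + {x7} + {x8} + {x9}))
    {D D' : Finset V}
    (hD : WD col W u ({x2} + {x3} + {x4} + {x5} + {x6}) (Gp x7 x8 x9) D)
    (hD' : WD col W x4 ({x5} + {x6} + {x7} + {x8} + {x9}) (Gp x10 x11 x12) D') : D = D' := by
  have h' := h.rot
  simp only [List.cons_append] at h'
  exact ovl hS hD (x2 := x2) (x3 := x3) (x4 := x4) (x5 := x5) (x6 := x6) (x7 := x7) (x8 := x8) (x9 := x9) rfl (Or.inl rfl) (Or.inr (Or.inl rfl)) (Or.inr (Or.inr rfl))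
    (h'.noSDR H.no x10 (Or.inl rfl)) hS' hD' (Or.inl rfl) (H.nvR h') rfl

lemma list4 (L : List (V × V × V)) (h : 4 ≤ L.length) : ∃ x2 x3 x4 x5 x6 x7 x8 x9 x10 x11 x12 x13 R,
    L = (x2, x3, x4) :: (x5, x6, x7) :: (x8, x9, x10) :: (x11, x12, x13) :: R := by
  match L, h with
  | (x2, x3, x4) :: (x5, x6, x7) :: (x8, x9, x10) :: (x11, x12, x13) :: R, _ => exact ⟨_, _, _, _, _, _, _, _, _, _, _, _, _, rfl⟩

/-- front window is NS -/
def NSF (col : Finset V → Bool) (W : Finset V) (u : V) (L : List (V × V × V)) : Prop :=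
  ∃ x2 x3 x4 x5 x6 x7 R, L = (x2, x3, x4) :: (x5, x6, x7) :: R ∧ NS col W u ({x2} + {x3} + {x4} + {x5} + {x6})

def InvD (col : Finset V → Bool) (W : Finset V) (l : ℕ) (D : Finset V) (u : V) (L : List (V × V × V)) : Prop :=
  Cyc col W l u L ∧ ∃ x2 x3 x4 x5 x6 x7 x8 x9 x10 R, L = (x2, x3, x4) :: (x5, x6, x7) :: (x8, x9, x10) :: R ∧
    WD col W u ({x2} + {x3} + {x4} + {x5} + {x6}) (Gp x7 x8 x9) D

/-- all windows NS -/
lemma Hyp.allNS (H : Hyp col W l q) (hall : ∀ u L, Cyc col W l u L → NSF col W u L) {u : V} {L : List (V × V × V)}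
    (h : Cyc col W l u L) : False := by
  have hns : ∀ u x2 x3 x4 x5 x6 x7 R, Cyc col W l u ((x2, x3, x4) :: (x5, x6, x7) :: R) →
      NS col W u ({x2} + {x3} + {x4} + {x5} + {x6}) := by
    intro u x2 x3 x4 x5 x6 x7 R h
    obtain ⟨_, _, _, _, _, _, _, e, h1⟩ := hall _ _ h
    cases e; exact h1
  have hl := H.hl
  obtain ⟨x2, x3, x4, x5, x6, x7, x8, x9, x10, x11, x12, x13, R, rfl⟩ := list4 L (by rw [h.len]; omega)
  obtain ⟨D, hD⟩ := H.wd h (hns _ _ _ _ _ _ _ _ h)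
  have hlen := h.len
  simp only [List.length_cons] at hlen
  obtain ⟨c, o, hc, hX, hY⟩ := hD.2.2.2
  have r1 : ∀ u x y z R, InvD col W l D u ((x, y, z) :: R) → InvD col W l D z (R ++ [(x, y, z)]) := by
    rintro u x y z R ⟨h1, x2, x3, x4, x5, x6, x7, x8, x9, x10, R', e, hD⟩
    cases e
    cases R' with
    | nil => have := h1.len; simp at this; omega
    | cons t R' =>
      obtain ⟨x11, x12, x13⟩ := t
      have h1' := h1.rot
      simp only [List.cons_append] at h1'
      obtain ⟨D', hD'⟩ := H.wd h1' (hns _ _ _ _ _ _ _ _ h1')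
      have := H.ov h1 (hns _ _ _ _ _ _ _ _ h1) (hns _ _ _ _ _ _ _ _ h1') hD hD'
      subst this
      exact ⟨h1', _, _, _, _, _, _, _, _, _, _, rfl, hD'⟩
  have r2 : ∀ u x2 x3 x4 x5 x6 x7 R, InvD col W l D u ((x2, x3, x4) :: (x5, x6, x7) :: R) → ∃ (c : Cfg V) (o : V),
      c.vs + {o} = {u} + ({x2} + {x3} + {x4} + {x5} + {x6}) ∧ c.X col W ⊆ D ∧ c.Y col W ⊆ D := by
    rintro u x2 x3 x4 x5 x6 x7 R ⟨h1, _, _, _, _, _, _, _, _, _, _, e, hD⟩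
    cases e
    obtain ⟨c, o, hc, hX, hY⟩ := hD.2.2.2
    exact ⟨c, o, hc, by rw [hX], by rw [hY]⟩
  obtain ⟨cs, f1, f2, f3⟩ := comb (W := W) (col := col) (l := l) (InvD col W l D) (fun c => c.X col W ⊆ D ∧ c.Y col W ⊆ D) (fun _ _ h => h.1) r1 r2 (q + 1)
    (u := u) (x2 := x2) (x3 := x3) (x4 := x4) (x5 := x5) (x6 := x6) (x7 := x7) (R := (x8, x9, x10) :: (x11, x12, x13) :: R)
    ⟨h, _, _, _, _, _, _, _, _, _, _, rfl, hD⟩ (by simp; omega) hc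
  have := ev_same (col := col) D c cs f3 (by simpa [hX, hY] using f2) (by rw [hD.1]) (by have := H.hW; omega)
  rw [f1] at this; exact H.nb this

lemma not_NS {a : V} {M : Multiset V} (h : ¬ NS col W a M) : ∃ (c : Cfg V) (o : V), c.vs + {o} = {a} + M ∧ Sm col W c := by
  unfold NS at h; push Not at h; exact h

/-- p ≥ 3, some window small -/
lemma Hyp.someS (H : Hyp col W l (q + 1)) {u x2 x3 x4 x5 x6 x7 : V} {R : List (V × V × V)}
    (h : Cyc col W l u ((x2, x3, x4) :: (x5, x6, x7) :: R)) 
    (hS : ¬ NS col W u ({x2} + {x3} + {x4} + {x5} + {x6})) : False := by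
  obtain ⟨c, o, hc, hs⟩ := not_NS hS
  have hlen := h.len
  have hl := H.hl
  have hW := H.hW
  simp only [List.length_cons] at hlen
  obtain ⟨cs, f1, f2, f3⟩ := comb (Cyc col W l) (Ty col W) (fun _ _ h => h) (fun _ _ _ _ _ h => h.rot)
    (fun _ _ _ _ _ _ _ _ h => H.ty h) (q + 2) h (by omega) hc
  by_cases hex : ∃ d ∈ cs, Sm col W d
  · obtain ⟨d, hd, hd'⟩ := hex
    obtain ⟨s, t, rfl⟩ := List.append_of_mem hd
    have := ev_two c d (s ++ t) (f3.perm (by simpa using List.perm_middle)) hs hd' (fun e he => (f2 e (by simp at he ⊢; tauto)).le2) (by simp at f1 ⊢; omega)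
    apply H.nb; convert this using 2; simp at f1 ⊢; omega
  · push Not at hex
    have ht : ∀ d ∈ cs, IsT col W d := fun d hd => (f2 d hd).resolve_left (hex d hd)
    match cs, f1 with
    | a :: b :: cs, f1 =>
      have := ev_one c a b cs f3 hs (ht a (by simp)) (ht b (by simp)) (fun e he => (f2 e (by simp [he])).le2) (by simp at f1; omega)
      apply H.nb; convert this using 2; simp at f1; omega

/-- p = 2 : two consecutive NS windows -/
lemma Hyp.twoNS (H : Hyp col W l 0) {u x2 x3 x4 x5 x6 x7 x8 x9 x10 x11 x12 x13 : V} {R : List (V × V × V)}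
    (h : Cyc col W l u ((x2, x3, x4) :: (x5, x6, x7) :: (x8, x9, x10) :: (x11, x12, x13) :: R))
    (hS : NS col W u ({x2} + {x3} + {x4} + {x5} + {x6})) (hS' : NS col W x4 ({x5} + {x6} + {x7} + {x8} + {x9})) : False := by
  have h' := h.rot
  simp only [List.cons_append] at h'
  obtain ⟨D, hD⟩ := H.wd h hS
  obtain ⟨D', hD'⟩ := H.wd h' hS'
  have := H.ov h hS hS' hD hD'
  subst this
  obtain ⟨c, o, hc, hX, hY⟩ := hD.2.2.2
  obtain ⟨c', o', hc', hX', hY'⟩ := next_good hS' hD' (x2 := x5) (x3 := x6) (x4 := x7) (x5 := x8) (x6 := x9) (x7 := x10) (x8 := x11) (x9 := x12) rfl (Or.inl rfl) (Or.inr (Or.inl rfl))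
  have hst := h.stl
  have hf := h.2.2
  rw [← hst] at hf
  have := ev_same (col := col) D c [c'] (hf.of_add (C := {o} + {o'} + (stl x13 R : Multiset V)) (by
    rw [vss_cons, vss_cons]
    calc _ = (c.vs + {o}) + (c'.vs + {o'}) + (stl x13 R : Multiset V) := by simp only [vss, List.map_nil, List.sum_nil]; abel
      _ = _ := by
        rw [hc, hc']; simp only [stl, ← Multiset.cons_coe, ← Multiset.singleton_add]; abel)) (by simp [hX, hY, hX', hY']) (by rw [hD.1]) (by have := H.hW; simp; omega)
  exact H.nb this

lemma Hyp.twoS (H : Hyp col W l 0) {u x2 x3 x4 x5 x6 x7 x8 x9 x10 x11 x12 x13 : V} {R : List (V × V × V)}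
    (h : Cyc col W l u ((x2, x3, x4) :: (x5, x6, x7) :: (x8, x9, x10) :: (x11, x12, x13) :: R))
    (hS : ¬ NS col W u ({x2} + {x3} + {x4} + {x5} + {x6})) (hS' : ¬ NS col W x7 ({x8} + {x9} + {x10} + {x11} + {x12})) : False := by
  obtain ⟨c, o, hc, hs⟩ := not_NS hS
  obtain ⟨c', o', hc', hs'⟩ := not_NS hS'
  have hst := h.stl
  have hf := h.2.2
  rw [← hst] at hf
  have := ev_two c c' [] (hf.of_add (C := {o} + {o'} + (stl x13 R : Multiset V)) (by
    rw [vss_cons, vss_cons]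
    calc _ = (c.vs + {o}) + (c'.vs + {o'}) + (stl x13 R : Multiset V) := by simp only [vss, List.map_nil, List.sum_nil]; abel
      _ = _ := by
        rw [hc, hc']; simp only [stl, ← Multiset.cons_coe, ← Multiset.singleton_add]; abel)) hs hs' (by simp) (by have := H.hW; simp; omega)
  exact H.nb this

lemma Hyp.p2 (H : Hyp col W l 0) {u : V} {L : List (V × V × V)}
    (h : Cyc col W l u L) : False := by
  have hl := H.hl
  by_cases hex : ∃ u L, Cyc col W l u L ∧ NSF col W u L
  · obtain ⟨u, L, h, x2, x3, x4, x5, x6, x7, R, rfl, hS⟩ := hex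
    have hlen := h.len
    simp only [List.length_cons] at hlen
    obtain ⟨R0, t, rfl⟩ : ∃ R0 t, R = R0 ++ [t] := by
      rcases List.eq_nil_or_concat R with rfl | ⟨R0, t, rfl⟩
      · simp at hlen; omega
      · exact ⟨R0, t, by simp⟩
    obtain ⟨w, hw, hw'⟩ := Cyc.rots ((x2, x3, x4) :: (x5, x6, x7) :: R0) [t] h
    obtain ⟨y2, y3, y4⟩ := t
    have e4 : y4 = u := by
      have := hw.1; simp only [List.cons_append, List.nil_append, Pth] at this
      have h1 := h.1
      obtain ⟨_, h3⟩ := this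
      have h4 := hw.rot.1
      have h2 := (Pth_append _ _ _ _).1 (show Pth col true u (((x2, x3, x4) :: (x5, x6, x7) :: R0) ++ [(y2, y3, y4)]) u from h.1)
      obtain ⟨_, _, _, h5⟩ := h2
      exact h5
    subst e4
    match R0, hlen with
    | [], hlen => simp at hlen; omega
    | (x8, x9, x10) :: R1, hlen =>
      simp only [List.cons_append, List.nil_append] at hw
      have hw2 := hw.rot
      simp only [List.cons_append, List.nil_append] at hw2
      by_cases s1 : NS col W w ({y2} + {y3} + {y4} + {x2} + {x3})
      · exact H.twoNS hw s1 hS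
      by_cases s3 : NS col W x4 ({x5} + {x6} + {x7} + {x8} + {x9})
      · obtain ⟨z2, z3, z4, z5, z6, z7, z8, z9, z10, z11, z12, z13, R', e⟩ := list4 _ (show 4 ≤ ((x2, x3, x4) :: (x5, x6, x7) :: (x8, x9, x10) :: (R1 ++ [(y2, y3, y4)])).length by simp)
        simp only [List.cons.injEq, Prod.mk.injEq] at e
        obtain ⟨⟨rfl, rfl, rfl⟩, ⟨rfl, rfl, rfl⟩, ⟨rfl, rfl, rfl⟩, e⟩ := e
        rw [e] at hw2
        exact H.twoNS hw2 hS s3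
      · exact H.twoS hw s1 s3
  · push Not at hex
    obtain ⟨x2, x3, x4, x5, x6, x7, x8, x9, x10, x11, x12, x13, R, rfl⟩ := list4 L (by rw [h.len]; omega)
    have h0 := h.rot
    simp only [List.cons_append] at h0
    have h' := h0.rot
    simp only [List.cons_append] at h'
    refine H.twoS h (fun hS => hex _ _ h ⟨_, _, _, _, _, _, _, rfl, hS⟩) (fun hS => hex _ _ h' ⟨_, _, _, _, _, _, _, rfl, hS⟩)

lemma ela_even (q : ℕ) (u : V) (L : List (V × V × V)) (hL : Pth col true u L u) (hf : Fr W (fl L))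
    (hl : 2 * (q + 2) ≤ L.length) (hW : q + 4 ≤ W.card) (hno : ¬ HC col true (L.length + 1)) : HC col false (2 * (q + 2)) := by
  by_contra hb
  have H : Hyp col W L.length q := ⟨hno, hb, hl, hW⟩
  have h : Cyc col W L.length u L := ⟨hL, rfl, hf⟩
  cases q with
  | zero => exact H.p2 h
  | succ q =>
    refine H.allNS (fun u' L' h' => ?_) h
    obtain ⟨x2, x3, x4, x5, x6, x7, x8, x9, x10, x11, x12, x13, R, rfl⟩ := list4 L' (by rw [h'.len]; omega)
    by_contra hc
    exact H.someS h' (fun hS => hc ⟨_, _, _, _, _, _, _, rfl, hS⟩)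
end EV


section Asm
variable {V : Type*} [DecidableEq V] {col : Finset V → Bool}

lemma fl_card (L : List (V × V × V)) : Multiset.card (fl L) = 3 * L.length := by
  induction L with
  | nil => simp [fl]
  | cons t L ih => obtain ⟨x, y, z⟩ := t; simp [fl, ih]; omega

lemma getW [Fintype V] {b : Bool} {k : ℕ} (h : HC col b k) : ∃ (W : Finset V) (u : V) (L : List (V × V × V)),
    Pth col b u L u ∧ L.length = k ∧ Fr W (fl L) ∧ W.card + 3 * k = Fintype.card V := by
  obtain ⟨u, L, h1, h2, h3⟩ := h
  refine ⟨(fl L).toFinsetᶜ, u, L, h1, h2, ⟨h3, fun v hv => by simpa using hv⟩, ?_⟩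
  have : (fl L).toFinset.card = 3 * k := by
    rw [Multiset.toFinset_card_of_nodup h3, fl_card, h2]
  rw [← this, Finset.card_compl_add_card]

lemma Pth_not {b : Bool} {u v : V} {L : List (V × V × V)} : Pth (fun s => !col s) b u L v ↔ Pth col (!b) u L v := by
  induction L generalizing u with
  | nil => exact Iff.rfl
  | cons t L ih =>
    obtain ⟨x, y, z⟩ := t
    simp only [Pth, ih]
    cases b <;> simp

lemma HC_not {b : Bool} {k : ℕ} : HC (fun s => !col s) b k ↔ HC col (!b) k := by
  simp only [HC, Pth_not]

lemma elb_red [Fintype V] {j m : ℕ} (hj : 2 ≤ j) (hjm : j + 1 ≤ m) (hV : 3 * (m + 1) + (m - 1) / 2 ≤ Fintype.card V)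
    (h : HC col true j) : HC col true (j + 1) ∨ HC col false (j + 1) := by
  by_contra hc
  rw [not_or] at hc
  obtain ⟨W, u, L, h1, h2, h3, h4⟩ := getW h
  obtain ⟨c1, c2⟩ := hc
  have hd : j = 2 ∨ (∃ q, j = 2 * (q + 1) + 1) ∨ ∃ q, j = 2 * (q + 1) + 2 := by
    rcases Nat.even_or_odd' j with ⟨k, rfl | rfl⟩
    · by_cases hk : k = 1
      · left; omega
      · right; right; exact ⟨k - 2, by omega⟩
    · right; left; exact ⟨k - 1, by omega⟩
  rcases hd with rfl | ⟨q, rfl⟩ | ⟨q, rfl⟩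
  · exact c2 (elb3 (W := W) u L h1 h2 h3 (by omega) c1)
  · exact c2 (elb_even (W := W) q u L h1 h2 h3 (by omega) c1)
  · exact c2 (elb_odd (W := W) q u L h1 h2 h3 (by omega) c1)

lemma elb_any [Fintype V] {j m : ℕ} (hj : 2 ≤ j) (hjm : j + 1 ≤ m) (hV : 3 * (m + 1) + (m - 1) / 2 ≤ Fintype.card V)
    (h : HC col true j ∨ HC col false j) : HC col true (j + 1) ∨ HC col false (j + 1) := by
  rcases h with h | h
  · exact elb_red hj hjm hV h
  · have h' : HC (fun s => !col s) true j := HC_not.2 h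
    have := elb_red hj hjm hV h'
    rw [HC_not, HC_not] at this
    exact this.symm

lemma ela_any [Fintype V] {j m n : ℕ} (hm : 3 ≤ m) (hj : m ≤ j) (hjn : j + 1 ≤ n) (hV : 3 * n + (m - 1) / 2 ≤ Fintype.card V)
    (h : HC col true j) : HC col true (j + 1) ∨ HC col false m := by
  by_contra hc
  rw [not_or] at hc
  obtain ⟨W, u, L, h1, h2, h3, h4⟩ := getW h
  obtain ⟨c1, c2⟩ := hc
  rcases Nat.even_or_odd' m with ⟨k, rfl | rfl⟩
  · obtain ⟨q, rfl⟩ : ∃ q, k = q + 2 := ⟨k - 2, by omega⟩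
    exact c2 (ela_even (W := W) q u L h1 h3 (by omega) (by omega) (by rwa [h2]))
  · obtain ⟨q, rfl⟩ : ∃ q, k = q + 1 := ⟨k - 1, by omega⟩
    exact c2 (ela_odd (W := W) q u L h1 h3 (by omega) (by omega) (by rwa [h2]))

lemma base (f : Fin 6 ↪ V) : HC col true 2 ∨ HC col false 2 := by
  have key : ∀ (b : Bool) (u a a' z c c' : Fin 6), [u, a, a', z, c, c'].Nodup → col {f u, f a, f a', f z} = b → col {f z, f c, f c', f u} = b →
      HC col b 2 := by
    intro b u a a' z c c' hn h1 h2
    refine ⟨f u, [(f a, f a', f z), (f c, f c', f u)], ⟨h1, h2, rfl⟩, rfl, ?_⟩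
    have e : fl [(f a, f a', f z), (f c, f c', f u)] = (([u, a, a', z, c, c'].map f : List V) : Multiset V) := by
      simp only [fl, List.map, ← Multiset.cons_coe, ← Multiset.singleton_add, Multiset.coe_nil]; abel
    rw [e, Multiset.coe_nodup]
    exact hn.map f.injective
  -- pairs {0,1}, {2,3}, {4,5}
  have k1 := fun b => key b 0 2 3 1 4 5 (by decide)
  have k2 := fun b => key b 2 0 1 3 4 5 (by decide)
  have k3 := fun b => key b 4 0 1 5 2 3 (by decide)
  have e1 : ({f 0, f 2, f 3, f 1} : Finset V) = {f 2, f 0, f 1, f 3} := by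
    ext; simp only [Finset.mem_insert, Finset.mem_singleton]; tauto
  have e2 : ({f 1, f 4, f 5, f 0} : Finset V) = {f 4, f 0, f 1, f 5} := by
    ext; simp only [Finset.mem_insert, Finset.mem_singleton]; tauto
  have e3 : ({f 3, f 4, f 5, f 2} : Finset V) = {f 5, f 2, f 3, f 4} := by
    ext; simp only [Finset.mem_insert, Finset.mem_singleton]; tauto
  rw [e1, e2] at k1
  rw [e3] at k2
  cases hA : col {f 2, f 0, f 1, f 3} <;> cases hB : col {f 4, f 0, f 1, f 5} <;> cases hC : col {f 5, f 2, f 3, f 4} <;> 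
    first
    | exact Or.inl (k1 true hA hB)
    | exact Or.inl (k2 true hA hC)
    | exact Or.inl (k3 true hB hC)
    | exact Or.inr (k1 false hA hB)
    | exact Or.inr (k2 false hA hC)
    | exact Or.inr (k3 false hB hC)

lemma upper (n m : ℕ) (hm : 4 ≤ m + 1) (hnm : m + 1 ≤ n) (col : Finset (Fin (3 * n + (m - 1) / 2)) → Bool) :
    HC col true n ∨ HC col false m := by
  have hc : Fintype.card (Fin (3 * n + (m - 1) / 2)) = 3 * n + (m - 1) / 2 := Fintype.card_fin _
  have hb : HC col true 2 ∨ HC col false 2 := base (Fin.castLEEmb (by omega))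
  have h1 : ∀ j, 2 ≤ j → j ≤ m → HC col true j ∨ HC col false j := by
    intro j hj
    induction j, hj using Nat.le_induction with
    | base => intro _; exact hb
    | succ j hj ih => intro h; exact elb_any hj h (by rw [hc]; omega) (ih (by omega))
  have h2 : ∀ j, m ≤ j → j ≤ n → HC col true j ∨ HC col false m := by
    intro j hj
    induction j, hj using Nat.le_induction with
    | base => intro _; exact h1 m (by omega) le_rfl
    | succ j hj ih =>
      intro h
      rcases ih (by omega) with h3 | h3
      · exact ela_any (by omega) hj h (by rw [hc]) h3
      · exact Or.inr h3
  exact h2 n (by omega) le_rfl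
end Asm

theorem ramsey_C4n_C4m (n m : ℕ) (hm : 4 ≤ m + 1) (hnm : m + 1 ≤ n) :
    RamseyCC 4 n m = 3 * n + (m - 1) / 2 :=
  ramsey_main n m hm hnm (upper n m hm hnm)
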